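/- (Generalization across multiple groups.) There exists a universal constant C > 0 such that: for every common improvement capacity Δ > 0, every integer g ≥ 1, every probability distribution D on ℝ × {1,…,g} whose group marginals α_ℓ = D(ℝ × {ℓ}) are all strictly positive (with conditional position distributions D_ℓ and α_min = min_ℓ α_ℓ), every ε, δ ∈ (0,1), every integer k ≥ 1, and every n ≥ (2/α_min)·(ε^{−2}·Δ²·(k·ln k + ln(2g/δ)) + 4·ln(2g/δ)), with probability at least 1 − δ over an i.i.d. sample of n labeled agents from D, the following holds: for every group ℓ the sample contains at least one agent with label ℓ, and for every finite set T ⊆ ℝ of at most k target levels and every group ℓ, |I_{G_ℓ}(T) − E_{p∼D_ℓ}[I_p(T)]| ≤ C·ε, where I_{G_ℓ}(T) is the average improvement over the sampled agents with label ℓ. -/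

import Mathlib

/-- Improvement of an agent at position `p` with capacity `Δ` given target set `T`:
the agent moves to the smallest target `τ ∈ T` with `p < τ ≤ p + Δ`, if any. -/
noncomputable def imp (Δ p : ℝ) (T : Finset ℝ) : ℝ :=
  if h : (T.filter (fun τ => p < τ ∧ τ ≤ p + Δ)).Nonempty then
    (T.filter (fun τ => p < τ ∧ τ ≤ p + Δ)).min' h - p
  else 0

open MeasureTheory

section Level

variable {Ω : Type*} [MeasurableSpace Ω] {κ : Type*} [Fintype κ]

/-- centred count statistic -/
noncomputable def SS (μ : Measure Ω) (e : κ → Ω → ℝ) (n : ℕ) (b : κ) (x : Fin n → Ω) : ℝ :=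
  ∑ i, (e b (x i) - ∫ y, e b y ∂μ)

/-- signs -/
noncomputable def sgnT (s : Fin 3) : ℝ := if s = 0 then 0 else if s = 1 then 1 else -1

/-- weights -/
noncomputable def wtT (q : ℝ) (s : Fin 3) : ℝ := if s = 0 then 1 else q * Real.exp (-1)

/-- exponential potential -/
noncomputable def YY (μ : Measure Ω) (e : κ → Ω → ℝ) (n : ℕ) (lam q : ℝ) (x : Fin n → Ω) : ℝ :=
  ∏ b, ∑ s : Fin 3, wtT q s * Real.exp (lam * sgnT s * SS μ e n b x)

lemma abs_sgnT_le (s : Fin 3) : |sgnT s| ≤ 1 := by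
  unfold sgnT; split_ifs <;> simp

lemma wtT_nonneg {q : ℝ} (hq : 0 ≤ q) (s : Fin 3) : 0 ≤ wtT q s := by
  unfold wtT; split_ifs <;> positivity

lemma YY_expand [DecidableEq κ] (μ : Measure Ω) (e : κ → Ω → ℝ) (n : ℕ) (lam q : ℝ) (x : Fin n → Ω) :
    YY μ e n lam q x = ∑ w : κ → Fin 3, (∏ b, wtT q (w b)) *
      ∏ i, Real.exp (lam * (∑ b, sgnT (w b) * (e b (x i) - ∫ y, e b y ∂μ))) := by
  unfold YY
  rw [Finset.prod_univ_sum]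
  simp only [Fintype.piFinset_univ]
  refine Finset.sum_congr rfl fun w _ => ?_
  rw [Finset.prod_mul_distrib, ← Real.exp_sum, ← Real.exp_sum]
  congr 2
  simp only [SS, Finset.mul_sum]
  rw [Finset.sum_comm]
  refine Finset.sum_congr rfl fun i _ => Finset.sum_congr rfl fun b _ => ?_
  ring

lemma exp_quad {y : ℝ} (hy : |y| ≤ 1) : Real.exp y ≤ 1 + y + y ^ 2 := by
  have := Real.abs_exp_sub_one_sub_id_le hy
  have := (abs_le.mp this).2
  linarith

/-- one-step moment generating function bound -/
lemma mgf_one (μ : Measure Ω) [IsProbabilityMeasure μ] (e : κ → Ω → ℝ)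
    (hm : ∀ b, Measurable (e b)) (h0 : ∀ b y, 0 ≤ e b y) (h1 : ∀ y, ∑ b, e b y ≤ 1)
    (p : ℝ) (hp : ∀ b, ∫ y, e b y ∂μ ≤ p) (lam : ℝ) (hl0 : 0 ≤ lam) (hl1 : lam ≤ 1)
    (t : κ → ℝ) (ht : ∀ b, |t b| ≤ 1) :
    ∫ y, Real.exp (lam * (∑ b, t b * (e b y - ∫ z, e b z ∂μ))) ∂μ
      ≤ Real.exp (lam ^ 2 * p * ∑ b, |t b|) := by
  have hle1 : ∀ b y, e b y ≤ 1 := fun b y =>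
    (Finset.single_le_sum (f := fun b => e b y) (fun c _ => h0 c y) (Finset.mem_univ b)).trans (h1 y)
  have hint : ∀ b, Integrable (e b) μ := fun b =>
    Integrable.of_bound (hm b).aestronglyMeasurable 1
      (Filter.Eventually.of_forall fun y => by
        rw [Real.norm_eq_abs, abs_of_nonneg (h0 b y)]; exact hle1 b y)
  set W : Ω → ℝ := fun y => ∑ b, t b * e b y with hW
  have hWm : Measurable W := by
    apply Finset.measurable_sum; intro b _; exact (hm b).const_mul _
  have hWabs : ∀ y, |W y| ≤ ∑ b, |t b| * e b y := fun y => by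
    refine (Finset.abs_sum_le_sum_abs _ _).trans (Finset.sum_le_sum fun b _ => ?_)
    rw [abs_mul, abs_of_nonneg (h0 b y)]
  have hW1 : ∀ y, |W y| ≤ 1 := fun y => by
    refine (hWabs y).trans ((Finset.sum_le_sum fun b _ => ?_).trans (h1 y))
    calc |t b| * e b y ≤ 1 * e b y := mul_le_mul_of_nonneg_right (ht b) (h0 b y)
      _ = e b y := one_mul _
  have hWint : Integrable W μ := integrable_finsetSum _ fun b _ => (hint b).const_mul _
  have hAint : Integrable (fun y => ∑ b, |t b| * e b y) μ :=
    integrable_finsetSum _ fun b _ => (hint b).const_mul _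
  have hEW : ∫ y, W y ∂μ = ∑ b, t b * ∫ z, e b z ∂μ := by
    rw [hW, integral_finsetSum _ fun b _ => (hint b).const_mul _]
    simp [integral_const_mul]
  have hEA : ∫ y, (∑ b, |t b| * e b y) ∂μ ≤ p * ∑ b, |t b| := by
    rw [integral_finsetSum _ fun b _ => (hint b).const_mul _, Finset.mul_sum]
    refine Finset.sum_le_sum fun b _ => ?_
    rw [integral_const_mul, mul_comm]
    exact mul_le_mul_of_nonneg_right (hp b) (abs_nonneg _)
  have hrew : ∀ y, Real.exp (lam * (∑ b, t b * (e b y - ∫ z, e b z ∂μ)))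
      = Real.exp (lam * W y) * Real.exp (- (lam * ∫ y, W y ∂μ)) := fun y => by
    rw [← Real.exp_add]; congr 1
    rw [hEW, hW]; simp only [mul_sub, Finset.sum_sub_distrib]; ring
  simp_rw [hrew]
  rw [integral_mul_const]
  have hexp : ∫ y, Real.exp (lam * W y) ∂μ ≤
      1 + lam * ∫ y, W y ∂μ + lam ^ 2 * ∫ y, (∑ b, |t b| * e b y) ∂μ := by
    have : ∫ y, (1 + lam * W y + lam ^ 2 * (∑ b, |t b| * e b y)) ∂μ =
        1 + lam * ∫ y, W y ∂μ + lam ^ 2 * ∫ y, (∑ b, |t b| * e b y) ∂μ := by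
      rw [integral_add, integral_add, integral_const_mul, integral_const_mul]
      · simp
      · exact integrable_const _
      · exact hWint.const_mul _
      · exact (integrable_const _).add (hWint.const_mul _)
      · exact hAint.const_mul _
    rw [← this]
    have hlW : ∀ y, |lam * W y| ≤ 1 := fun y => by
      rw [abs_mul, abs_of_nonneg hl0]
      exact mul_le_one₀ hl1 (abs_nonneg _) (hW1 y)
    refine integral_mono ?_ ?_ ?_
    · refine Integrable.of_bound (hWm.const_mul lam).exp.aestronglyMeasurable (Real.exp 1)
        (Filter.Eventually.of_forall fun y => ?_)
      rw [Real.norm_eq_abs, Real.abs_exp]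
      exact Real.exp_le_exp.mpr ((le_abs_self _).trans (hlW y))
    · exact ((integrable_const _).add (hWint.const_mul _)).add (hAint.const_mul _)
    · intro y
      have h2 := exp_quad (hlW y)
      have h3 : (W y) ^ 2 ≤ ∑ b, |t b| * e b y := by
        have : (W y)^2 ≤ |W y| := by
          rw [← sq_abs]; nlinarith [hW1 y, abs_nonneg (W y)]
        exact this.trans (hWabs y)
      simp only
      nlinarith [mul_le_mul_of_nonneg_left h3 (sq_nonneg lam)]
  have hexp2 : ∫ y, Real.exp (lam * W y) ∂μ ≤
      Real.exp (lam * ∫ y, W y ∂μ + lam ^ 2 * p * ∑ b, |t b|) := by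
    refine hexp.trans (le_trans ?_ (Real.add_one_le_exp _))
    nlinarith [mul_le_mul_of_nonneg_left hEA (sq_nonneg lam)]
  calc _ ≤ Real.exp (lam * ∫ y, W y ∂μ + lam ^ 2 * p * ∑ b, |t b|)
        * Real.exp (- (lam * ∫ y, W y ∂μ)) :=
        mul_le_mul_of_nonneg_right hexp2 (Real.exp_pos _).le
    _ = _ := by rw [← Real.exp_add]; congr 1; ring

set_option linter.unusedSectionVars false in
lemma SS_measurable (μ : Measure Ω) (e : κ → Ω → ℝ) (hm : ∀ b, Measurable (e b)) (n : ℕ) (b : κ) :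
    Measurable (SS μ e n b) := by
  unfold SS
  apply Finset.measurable_sum; intro i _
  exact ((hm b).comp (measurable_pi_apply i)).sub_const _

lemma YY_measurable (μ : Measure Ω) (e : κ → Ω → ℝ) (hm : ∀ b, Measurable (e b)) (n : ℕ)
    (lam q : ℝ) : Measurable (YY μ e n lam q) := by
  unfold YY
  apply Finset.measurable_prod; intro b _
  apply Finset.measurable_sum; intro s _
  exact (((SS_measurable μ e hm n b).const_mul _).exp).const_mul _

lemma YY_tail (μ : Measure Ω) [IsProbabilityMeasure μ] (e : κ → Ω → ℝ)
    (hm : ∀ b, Measurable (e b)) (h0 : ∀ b y, 0 ≤ e b y) (h1 : ∀ y, ∑ b, e b y ≤ 1)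
    (p : ℝ) (hp : ∀ b, ∫ y, e b y ∂μ ≤ p) (lam : ℝ) (hl0 : 0 ≤ lam) (hl1 : lam ≤ 1)
    (n : ℕ) (hn : lam ^ 2 * p * n ≤ 1) (q : ℝ) (hq : 0 ≤ q) (t : ℝ) :
    (Measure.pi fun _ : Fin n => μ).real {x | Real.exp t ≤ YY μ e n lam q x}
      ≤ Real.exp (2 * q * Fintype.card κ - t) := by
  classical
  have hle1 : ∀ b y, e b y ≤ 1 := fun b y =>
    (Finset.single_le_sum (f := fun b => e b y) (fun c _ => h0 c y) (Finset.mem_univ b)).trans (h1 y)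
  have hYn : ∀ x, 0 ≤ YY μ e n lam q x := fun x =>
    Finset.prod_nonneg fun b _ => Finset.sum_nonneg fun s _ =>
      mul_nonneg (wtT_nonneg hq s) (Real.exp_pos _).le
  have hEint : ∀ w : κ → Fin 3, Integrable (fun y => Real.exp (lam * (∑ b, sgnT (w b) * (e b y - ∫ z, e b z ∂μ)))) μ := by
    intro w
    refine Integrable.of_bound (C := Real.exp (lam * ∑ b, |sgnT (w b)| * (1 + |∫ z, e b z ∂μ|))) ?_
      (Filter.Eventually.of_forall fun y => ?_)
    · refine Measurable.aestronglyMeasurable (Measurable.exp (Measurable.const_mul ?_ _))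
      apply Finset.measurable_sum; intro b _
      exact ((hm b).sub_const _).const_mul _
    · rw [Real.norm_eq_abs, Real.abs_exp]
      refine Real.exp_le_exp.mpr (mul_le_mul_of_nonneg_left (Finset.sum_le_sum fun b _ => ?_) hl0)
      refine (le_abs_self _).trans ?_
      rw [abs_mul]
      refine mul_le_mul_of_nonneg_left ((abs_sub _ _).trans ?_) (abs_nonneg _)
      rw [abs_of_nonneg (h0 b y)]
      linarith [hle1 b y]
  have hPint : ∀ w : κ → Fin 3, Integrable (fun x : Fin n → Ω => (∏ b, wtT q (w b)) *
      ∏ i, Real.exp (lam * (∑ b, sgnT (w b) * (e b (x i) - ∫ y, e b y ∂μ))))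
      (Measure.pi fun _ : Fin n => μ) := fun w =>
    (Integrable.fintype_prod (f := fun (_ : Fin n) y => Real.exp (lam * (∑ b, sgnT (w b) * (e b y - ∫ z, e b z ∂μ)))) (fun _ => hEint w)).const_mul _
  have hYint : Integrable (YY μ e n lam q) (Measure.pi fun _ : Fin n => μ) := by
    have : YY μ e n lam q = fun x => _ := funext fun x => YY_expand μ e n lam q x
    rw [this]
    exact integrable_finsetSum _ fun w _ => hPint w
  have hEY : ∫ x, YY μ e n lam q x ∂(Measure.pi fun _ : Fin n => μ)
      ≤ Real.exp (2 * q * Fintype.card κ) := by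
    simp_rw [YY_expand]
    rw [integral_finsetSum _ fun w _ => hPint w]
    calc _ ≤ ∑ w : κ → Fin 3, ∏ b, (wtT q (w b) * Real.exp (|sgnT (w b)|)) := by
          refine Finset.sum_le_sum fun w _ => ?_
          rw [integral_const_mul, integral_fintype_prod_eq_pow (fun y => Real.exp (lam * (∑ b, sgnT (w b) * (e b y - ∫ z, e b z ∂μ)))), Finset.prod_mul_distrib]
          refine mul_le_mul_of_nonneg_left ?_ (Finset.prod_nonneg fun b _ => wtT_nonneg hq _)
          have := mgf_one μ e hm h0 h1 p hp lam hl0 hl1 (fun b => sgnT (w b)) (fun b => abs_sgnT_le _)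
          refine (pow_le_pow_left₀ (integral_nonneg fun y => (Real.exp_pos _).le) this _).trans ?_
          rw [← Real.exp_nat_mul, ← Real.exp_sum]
          refine Real.exp_le_exp.mpr ?_
          have hs : 0 ≤ ∑ b, |sgnT (w b)| := Finset.sum_nonneg fun b _ => abs_nonneg _
          simp only [Fintype.card_fin]
          nlinarith [mul_le_mul_of_nonneg_right hn hs]
      _ = ∏ b : κ, ∑ s : Fin 3, (wtT q s * Real.exp (|sgnT s|)) := by
          rw [Finset.prod_univ_sum]; simp only [Fintype.piFinset_univ]
      _ = (1 + 2 * q) ^ (Fintype.card κ) := by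
          rw [Finset.prod_const, Finset.card_univ]
          congr 1
          simp [Fin.sum_univ_three, wtT, sgnT, mul_assoc, ← Real.exp_add]
          ring
      _ ≤ (Real.exp (2 * q)) ^ (Fintype.card κ) := by
          refine pow_le_pow_left₀ (by positivity) ?_ _
          linarith [Real.add_one_le_exp (2 * q)]
      _ = _ := by rw [← Real.exp_nat_mul]; congr 1; ring
  have hM := mul_meas_ge_le_integral_of_nonneg (Filter.Eventually.of_forall hYn) hYint (Real.exp t)
  have := hM.trans hEY
  rw [Real.exp_sub, le_div_iff₀ (Real.exp_pos _), mul_comm]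
  exact this

lemma YY_det (μ : Measure Ω) (e : κ → Ω → ℝ) (n : ℕ) (lam q : ℝ)
    (hq : 0 < q) (t : ℝ)
    (x : Fin n → Ω) (hx : YY μ e n lam q x < Real.exp t) (a : κ → ℝ) (ha0 : ∀ b, 0 ≤ a b)
    (ha1 : ∀ b, a b ≤ 1) :
    lam * ∑ b, a b * |SS μ e n b x| ≤ t + (1 - Real.log q) * ∑ b, a b := by
  have key : ∀ b, a b * (lam * |SS μ e n b x| - 1 + Real.log q) ≤
      Real.log (∑ s : Fin 3, wtT q s * Real.exp (lam * sgnT s * SS μ e n b x)) := by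
    intro b
    set S := SS μ e n b x
    have e1 : ∑ s : Fin 3, wtT q s * Real.exp (lam * sgnT s * S) =
        1 + q * Real.exp (-1) * Real.exp (lam * S) + q * Real.exp (-1) * Real.exp (-(lam * S)) := by
      simp [Fin.sum_univ_three, wtT, sgnT]
    rw [e1]
    have p1 : 0 < q * Real.exp (-1) * Real.exp (lam * S) := by positivity
    have p2 : 0 < q * Real.exp (-1) * Real.exp (-(lam * S)) := by positivity
    have l0 : 0 ≤ Real.log (1 + q * Real.exp (-1) * Real.exp (lam * S) + q * Real.exp (-1) * Real.exp (-(lam * S))) :=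
      Real.log_nonneg (by linarith)
    have l1 : lam * |S| - 1 + Real.log q ≤ Real.log (1 + q * Real.exp (-1) * Real.exp (lam * S) + q * Real.exp (-1) * Real.exp (-(lam * S))) := by
      rw [Real.le_log_iff_exp_le (by linarith)]
      rw [Real.exp_add, Real.exp_log hq, sub_eq_add_neg, Real.exp_add]
      rcases abs_cases S with ⟨h, _⟩ | ⟨h, _⟩ <;> rw [h]
      · linarith
      · rw [mul_neg]; linarith
    calc _ ≤ a b * Real.log (1 + q * Real.exp (-1) * Real.exp (lam * S) + q * Real.exp (-1) * Real.exp (-(lam * S))) :=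
          mul_le_mul_of_nonneg_left l1 (ha0 b)
      _ ≤ _ := mul_le_of_le_one_left l0 (ha1 b)
  have hpos : ∀ b, 0 < ∑ s : Fin 3, wtT q s * Real.exp (lam * sgnT s * SS μ e n b x) := by
    intro b
    refine Finset.sum_pos (fun s _ => mul_pos ?_ (Real.exp_pos _)) Finset.univ_nonempty
    unfold wtT; split_ifs <;> positivity
  have hlog : Real.log (YY μ e n lam q x) < t := by
    exact (Real.log_lt_iff_lt_exp (Finset.prod_pos fun b _ => hpos b)).mpr hx
  have hsum := Finset.sum_le_sum fun b (_ : b ∈ Finset.univ) => key b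
  rw [← Real.log_prod (fun b _ => (hpos b).ne')] at hsum
  have h2 : ∑ b, a b * (lam * |SS μ e n b x| - 1 + Real.log q) =
      lam * ∑ b, a b * |SS μ e n b x| - (1 - Real.log q) * ∑ b, a b := by
    rw [Finset.mul_sum, Finset.mul_sum, ← Finset.sum_sub_distrib]
    exact Finset.sum_congr rfl fun b _ => by ring
  unfold YY at hlog
  linarith

end Level


section Quantile
open ProbabilityTheory Filter Topology

/-- Lebesgue measure on the open unit interval -/
noncomputable def lamI : Measure (Set.Ioo (0:ℝ) 1) := Measure.comap Subtype.val volume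

lemma lamI_apply (s : Set (Set.Ioo (0:ℝ) 1)) : lamI s = volume (Subtype.val '' s) :=
  comap_subtype_coe_apply measurableSet_Ioo _ _

lemma vol_Ioo_prob : IsProbabilityMeasure lamI := by
  constructor
  rw [lamI_apply, Set.image_univ, Subtype.range_coe]
  simp

lemma exists_quantile (μ : Measure ℝ) [IsProbabilityMeasure μ] :
    ∃ Q : Set.Ioo (0:ℝ) 1 → ℝ, Monotone Q ∧ lamI.map Q = μ := by
  have hne : ∀ u : Set.Ioo (0:ℝ) 1, {x | (u:ℝ) ≤ cdf μ x}.Nonempty := fun u => by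
    have := (tendsto_cdf_atTop μ).eventually (lt_mem_nhds u.2.2)
    obtain ⟨x, hx⟩ := this.exists
    exact ⟨x, hx.le⟩
  have hbd : ∀ u : Set.Ioo (0:ℝ) 1, BddBelow {x | (u:ℝ) ≤ cdf μ x} := fun u => by
    have := (tendsto_cdf_atBot μ).eventually (gt_mem_nhds u.2.1)
    obtain ⟨x, hx⟩ := this.exists
    refine ⟨x, fun y hy => ?_⟩
    by_contra hlt
    push Not at hlt
    have h1 := monotone_cdf μ hlt.le
    have h2 : (u:ℝ) ≤ cdf μ y := hy
    linarith
  set Q : Set.Ioo (0:ℝ) 1 → ℝ := fun u => sInf {x | (u:ℝ) ≤ cdf μ x} with hQ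
  have hiff : ∀ u x, Q u ≤ x ↔ (u:ℝ) ≤ cdf μ x := by
    intro u x
    constructor
    · intro h
      refine le_trans ?_ (monotone_cdf μ h)
      have hc : Tendsto (cdf μ) (𝓝[>] (Q u)) (𝓝 (cdf μ (Q u))) :=
        ((cdf μ).right_continuous (Q u)).mono_left (nhdsWithin_mono _ Set.Ioi_subset_Ici_self)
      refine ge_of_tendsto hc ?_
      filter_upwards [self_mem_nhdsWithin] with y hy
      obtain ⟨z, hz, hzy⟩ := exists_lt_of_csInf_lt (hne u) hy
      exact le_trans hz (monotone_cdf μ hzy.le)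
    · intro h
      exact csInf_le (hbd u) h
  have hmono : Monotone Q := fun u v huv => by
    rw [hiff]
    exact le_trans (show (u:ℝ) ≤ v from huv) ((hiff v _).mp le_rfl)
  refine ⟨Q, hmono, ?_⟩
  have := vol_Ioo_prob
  have hQm : Measurable Q := hmono.measurable
  have : IsProbabilityMeasure (lamI.map Q) :=
    Measure.isProbabilityMeasure_map hQm.aemeasurable
  refine Measure.ext_of_Iic _ _ fun x => ?_
  rw [Measure.map_apply hQm measurableSet_Iic, ← ofReal_cdf]
  have hs : Q ⁻¹' (Set.Iic x) = {u : Set.Ioo (0:ℝ) 1 | (u:ℝ) ≤ cdf μ x} := by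
    ext u; exact hiff u x
  rw [hs, lamI_apply]
  have h0 := cdf_nonneg μ x
  have h1 := cdf_le_one μ x
  have him : Subtype.val '' {u : Set.Ioo (0:ℝ) 1 | (u:ℝ) ≤ cdf μ x} =
      Set.Ioo 0 1 ∩ Set.Iic (cdf μ x) := by
    ext y; simp; tauto
  rw [him]
  apply le_antisymm
  · calc volume (Set.Ioo 0 1 ∩ Set.Iic (cdf μ x)) ≤ volume (Set.Ioc 0 (cdf μ x)) :=
          measure_mono fun y hy => ⟨hy.1.1, hy.2⟩
      _ = _ := by simp
  · calc ENNReal.ofReal (cdf μ x) = volume (Set.Ioo 0 (cdf μ x)) := by simp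
      _ ≤ volume (Set.Ioo 0 1 ∩ Set.Iic (cdf μ x)) :=
          measure_mono fun y hy => ⟨⟨hy.1, hy.2.trans_le h1⟩, hy.2.le⟩

end Quantile

section Imp

lemma imp_nonneg (Δ p : ℝ) (T : Finset ℝ) : 0 ≤ imp Δ p T := by
  unfold imp
  split_ifs with h
  · have := Finset.min'_mem _ h
    simp only [Finset.mem_filter] at this
    linarith [this.2.1]
  · exact le_rfl

lemma imp_le {Δ : ℝ} (hΔ : 0 ≤ Δ) (p : ℝ) (T : Finset ℝ) : imp Δ p T ≤ Δ := by
  unfold imp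
  split_ifs with h
  · have := Finset.min'_mem _ h
    simp only [Finset.mem_filter] at this
    linarith [this.2.2]
  · exact hΔ

/-- counting function of jumps -/
noncomputable def cntT (Δ : ℝ) (T : Finset ℝ) (p : ℝ) : ℝ :=
  ((T.filter (fun τ => τ ≤ p)).card : ℝ) + ((T.filter (fun τ => τ ≤ p + Δ)).card : ℝ)

lemma cntT_mono (Δ : ℝ) (T : Finset ℝ) : Monotone (cntT Δ T) := by
  intro p p' h
  unfold cntT
  gcongr

lemma cntT_nonneg (Δ : ℝ) (T : Finset ℝ) (p : ℝ) : 0 ≤ cntT Δ T p := by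
  unfold cntT; positivity

lemma cntT_le (Δ : ℝ) (T : Finset ℝ) (p : ℝ) : cntT Δ T p ≤ 2 * T.card := by
  unfold cntT
  have h1 : ((T.filter (fun τ => τ ≤ p)).card : ℝ) ≤ T.card := by
    exact_mod_cast Finset.card_filter_le _ _
  have h2 : ((T.filter (fun τ => τ ≤ p + Δ)).card : ℝ) ≤ T.card := by
    exact_mod_cast Finset.card_filter_le _ _
  linarith

lemma card_filter_step (T : Finset ℝ) {a b τ : ℝ} (hτ : τ ∈ T) (h1 : a < τ) (h2 : τ ≤ b) :
    ((T.filter (fun τ => τ ≤ a)).card : ℝ) + 1 ≤ ((T.filter (fun τ => τ ≤ b)).card : ℝ) := by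
  have : (T.filter (fun τ => τ ≤ a)).card < (T.filter (fun τ => τ ≤ b)).card := by
    apply Finset.card_lt_card
    rw [Finset.ssubset_iff_of_subset]
    · exact ⟨τ, by simp [hτ, h2], by simp [h1]⟩
    · intro y hy
      simp only [Finset.mem_filter] at hy ⊢
      exact ⟨hy.1, by linarith [hy.2]⟩
  exact_mod_cast this

lemma card_filter_le' (T : Finset ℝ) {a b : ℝ} (h : a ≤ b) :
    ((T.filter (fun τ => τ ≤ a)).card : ℝ) ≤ ((T.filter (fun τ => τ ≤ b)).card : ℝ) := by
  gcongr

lemma imp_step {Δ : ℝ} (hΔ : 0 < Δ) (T : Finset ℝ) {p p' : ℝ} (h : p ≤ p') :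
    imp Δ p' T - imp Δ p T ≤ Δ * (cntT Δ T p' - cntT Δ T p) := by
  have hle : imp Δ p' T - imp Δ p T ≤ Δ := by
    linarith [imp_le hΔ.le p' T, imp_nonneg Δ p T]
  unfold cntT
  have g1 := card_filter_le' T h
  have g2 := card_filter_le' T (show p + Δ ≤ p' + Δ by linarith)
  by_cases c1 : ∃ τ ∈ T, p < τ ∧ τ ≤ p'
  · obtain ⟨τ, hτ, h1, h2⟩ := c1
    have := card_filter_step T hτ h1 h2
    nlinarith
  by_cases c2 : ∃ τ ∈ T, p + Δ < τ ∧ τ ≤ p' + Δ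
  · obtain ⟨τ, hτ, h1, h2⟩ := c2
    have := card_filter_step T hτ h1 h2
    nlinarith
  push Not at c1 c2
  have hset : T.filter (fun τ => p < τ ∧ τ ≤ p + Δ) = T.filter (fun τ => p' < τ ∧ τ ≤ p' + Δ) := by
    ext τ
    simp only [Finset.mem_filter]
    constructor
    · rintro ⟨h1, h2, h3⟩
      exact ⟨h1, c1 τ h1 h2, by linarith⟩
    · rintro ⟨h1, h2, h3⟩
      refine ⟨h1, by linarith, ?_⟩
      by_contra hc
      push Not at hc
      linarith [c2 τ h1 hc]
  have himp : imp Δ p' T ≤ imp Δ p T := by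
    unfold imp
    simp only [hset]
    split_ifs
    · linarith
    · exact le_rfl
  have : 0 ≤ Δ * (((T.filter (fun τ => τ ≤ p')).card : ℝ) + ((T.filter (fun τ => τ ≤ p' + Δ)).card : ℝ) - (((T.filter (fun τ => τ ≤ p)).card : ℝ) + ((T.filter (fun τ => τ ≤ p + Δ)).card : ℝ))) :=
    mul_nonneg hΔ.le (by linarith)
  linarith

/-- the second monotone part -/
noncomputable def impR (Δ : ℝ) (T : Finset ℝ) (p : ℝ) : ℝ := cntT Δ T p - imp Δ p T / Δ

lemma impR_mono {Δ : ℝ} (hΔ : 0 < Δ) (T : Finset ℝ) : Monotone (impR Δ T) := by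
  intro p p' h
  unfold impR
  have := imp_step hΔ T h
  have h2 : imp Δ p' T / Δ - imp Δ p T / Δ ≤ cntT Δ T p' - cntT Δ T p := by
    rw [← sub_div, div_le_iff₀ hΔ]; linarith
  linarith

lemma imp_measurable {Δ : ℝ} (hΔ : 0 < Δ) (T : Finset ℝ) : Measurable (fun p => imp Δ p T) := by
  have : (fun p => imp Δ p T) = fun p => Δ * (cntT Δ T p - impR Δ T p) := by
    funext p; unfold impR; field_simp; ring
  rw [this]
  exact ((cntT_mono Δ T).measurable.sub (impR_mono hΔ T).measurable).const_mul _

end Imp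


section Core

set_option linter.unusedSectionVars false

variable {Ω : Type*} [MeasurableSpace Ω]

/-- block indicators at dyadic level `j` -/
noncomputable def ee (U : Ω → ℝ) (G : Set Ω) (j : ℕ) (b : Fin (2 ^ j)) (y : Ω) : ℝ :=
  (G ∩ {y | ⌊U y * 2 ^ j⌋₊ = (b : ℕ)}).indicator (fun _ => (1 : ℝ)) y

/-- centred empirical process restricted to `G` -/
noncomputable def nu (μ : Measure Ω) (G : Set Ω) (n : ℕ) (φ : Ω → ℝ) (x : Fin n → Ω) : ℝ :=
  ∑ i, (G.indicator φ (x i) - ∫ y, G.indicator φ y ∂μ)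

lemma ee_nonneg (U : Ω → ℝ) (G : Set Ω) (j : ℕ) (b : Fin (2 ^ j)) (y : Ω) : 0 ≤ ee U G j b y :=
  Set.indicator_nonneg (fun _ _ => zero_le_one) _

lemma floor_lt {u : ℝ} (hu : u ∈ Set.Ioo (0:ℝ) 1) (j : ℕ) : ⌊u * 2 ^ j⌋₊ < 2 ^ j := by
  rw [Nat.floor_lt (by have := hu.1; positivity)]
  push_cast
  have := hu.2
  have h2 : (0:ℝ) < 2 ^ j := by positivity
  nlinarith

lemma ee_sum (U : Ω → ℝ) (hU : ∀ y, U y ∈ Set.Ioo (0:ℝ) 1) (G : Set Ω) (j : ℕ) (c : ℕ → ℝ) (y : Ω) :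
    ∑ b : Fin (2 ^ j), c b * ee U G j b y = G.indicator (fun y => c ⌊U y * 2 ^ j⌋₊) y := by
  classical
  by_cases hy : y ∈ G
  · rw [Set.indicator_of_mem hy]
    rw [Finset.sum_eq_single (⟨⌊U y * 2 ^ j⌋₊, floor_lt (hU y) j⟩ : Fin (2 ^ j))]
    · simp [ee, hy]
    · intro b _ hb
      have : ¬ (⌊U y * 2 ^ j⌋₊ = (b:ℕ)) := fun h => hb (Fin.ext h.symm)
      simp [ee, this]
    · simp
  · rw [Set.indicator_of_notMem hy]
    refine Finset.sum_eq_zero fun b _ => ?_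
    simp [ee, hy]

lemma ee_sum_le (U : Ω → ℝ) (hU : ∀ y, U y ∈ Set.Ioo (0:ℝ) 1) (G : Set Ω) (j : ℕ) (y : Ω) :
    ∑ b : Fin (2 ^ j), ee U G j b y ≤ 1 := by
  have := ee_sum U hU G j (fun _ => 1) y
  simp only [one_mul] at this
  rw [this]
  exact Set.indicator_apply_le' (fun _ => le_rfl) (fun _ => zero_le_one)

lemma ee_le (U : Ω → ℝ) (G : Set Ω) (j : ℕ) (b : Fin (2 ^ j)) (y : Ω) : ee U G j b y ≤ 1 :=
  Set.indicator_apply_le' (fun _ => le_rfl) (fun _ => zero_le_one)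

lemma ee_measurable {U : Ω → ℝ} (hUm : Measurable U) {G : Set Ω} (hG : MeasurableSet G) (j : ℕ)
    (b : Fin (2 ^ j)) : Measurable (ee U G j b) := by
  refine Measurable.indicator measurable_const (hG.inter ?_)
  have : Measurable (fun y => ⌊U y * 2 ^ j⌋₊) := Nat.measurable_floor.comp (hUm.mul_const _)
  exact this (measurableSet_singleton _)

lemma ee_integrable (μ : Measure Ω) [IsProbabilityMeasure μ] {U : Ω → ℝ} (hUm : Measurable U)
    {G : Set Ω} (hG : MeasurableSet G) (j : ℕ)
    (b : Fin (2 ^ j)) : Integrable (ee U G j b) μ :=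
  Integrable.of_bound (ee_measurable hUm hG j b).aestronglyMeasurable 1
    (Filter.Eventually.of_forall fun y => by
      rw [Real.norm_eq_abs, abs_of_nonneg (ee_nonneg ..)]; exact ee_le ..)

lemma integral_block (μ : Measure Ω) [IsProbabilityMeasure μ] {U : Ω → ℝ} (hUm : Measurable U)
    (hU : ∀ y, U y ∈ Set.Ioo (0:ℝ) 1) {G : Set Ω} (hG : MeasurableSet G) (j : ℕ) (c : ℕ → ℝ) :
    ∫ y, G.indicator (fun y => c ⌊U y * 2 ^ j⌋₊) y ∂μ =
      ∑ b : Fin (2 ^ j), c b * ∫ y, ee U G j b y ∂μ := by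
  simp_rw [← ee_sum U hU G j c]
  rw [integral_finsetSum _ fun b _ => (ee_integrable μ hUm hG j b).const_mul _]
  simp_rw [integral_const_mul]

lemma nu_block (μ : Measure Ω) [IsProbabilityMeasure μ] {U : Ω → ℝ} (hUm : Measurable U)
    (hU : ∀ y, U y ∈ Set.Ioo (0:ℝ) 1) {G : Set Ω} (hG : MeasurableSet G) (j : ℕ) (c : ℕ → ℝ)
    (n : ℕ) (x : Fin n → Ω) :
    nu μ G n (fun y => c ⌊U y * 2 ^ j⌋₊) x = ∑ b : Fin (2 ^ j), c b * SS μ (ee U G j) n b x := by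
  unfold nu SS
  rw [integral_block μ hUm hU hG]
  simp_rw [← ee_sum U hU G j c, ← Finset.sum_sub_distrib, Finset.mul_sum]
  rw [Finset.sum_comm]
  refine Finset.sum_congr rfl fun b _ => Finset.sum_congr rfl fun i _ => ?_
  ring

lemma geo_sum {r : ℝ} (hr0 : 0 ≤ r) (hr : r ≤ 0.71) (m : ℕ) :
    ∑ i ∈ Finset.range m, (4 + 2 * (i:ℝ)) * r ^ i ≤ 31 - (31 + 7 * (m:ℝ)) * r ^ m := by
  induction m with
  | zero => simp
  | succ m ih =>
    rw [Finset.sum_range_succ, pow_succ]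
    push_cast
    have h1 : 0 ≤ r ^ m := by positivity
    have h2 : r ^ m * r ≤ r ^ m * 0.71 := mul_le_mul_of_nonneg_left hr h1
    have hm : (0:ℝ) ≤ m := by positivity
    have h3 : (38 + 7 * (m:ℝ)) * (r ^ m * r) ≤ (38 + 7 * (m:ℝ)) * (r ^ m * 0.71) :=
      mul_le_mul_of_nonneg_left h2 (by positivity)
    nlinarith [mul_nonneg hm h1]

lemma geo_sum_le {r : ℝ} (hr0 : 0 ≤ r) (hr : r ≤ 0.71) (m : ℕ) :
    ∑ i ∈ Finset.range m, (4 + 2 * (i:ℝ)) * r ^ i ≤ 31 := by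
  have := geo_sum hr0 hr m
  have : 0 ≤ (31 + 7 * (m:ℝ)) * r ^ m := by positivity
  linarith

lemma sqrt_half_le : Real.sqrt (1 / 2) ≤ 0.71 := by
  rw [Real.sqrt_le_left (by norm_num)]; norm_num

/-- deterministic and probabilistic control of one level -/
lemma level_event (μ : Measure Ω) [IsProbabilityMeasure μ] {U : Ω → ℝ} (hUm : Measurable U)
    (hU : ∀ y, U y ∈ Set.Ioo (0:ℝ) 1) {G : Set Ω} (hG : MeasurableSet G) (α : ℝ)
    (hblk : ∀ j b, ∫ y, ee U G j b y ∂μ ≤ α / 2 ^ j) (n v i : ℕ) (hM0 : 0 < (n:ℝ) * α)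
    (hM : (2:ℝ) ^ v * 2 ^ i ≤ n * α) :
    ∃ E : Set (Fin n → Ω), MeasurableSet E ∧
      (Measure.pi fun _ : Fin n => μ).real Eᶜ ≤ Real.exp (-(2:ℝ) ^ v - i) ∧
      ∀ x ∈ E, ∀ a : ℕ → ℝ, (∀ b < 2 ^ (v + i), |a b| ≤ 1) → (∑ b ∈ Finset.range (2 ^ (v + i)), |a b|) ≤ 2 ^ v →
        ∑ b : Fin (2 ^ (v + i)), |a b| * |SS μ (ee U G (v + i)) n b x| ≤
          Real.sqrt (n * α * 2 ^ v) * ((4 + 2 * (i:ℝ)) * Real.sqrt (1 / 2) ^ i) := by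
  set V : ℝ := 2 ^ v with hV
  set M : ℝ := n * α with hMdef
  have hVpos : 0 < V := by positivity
  have hV1 : 1 ≤ V := one_le_pow₀ (by norm_num)
  set lam : ℝ := Real.sqrt (V * 2 ^ i / M) with hlam
  have hlam0 : 0 < lam := Real.sqrt_pos.mpr (by positivity)
  have hlam1 : lam ≤ 1 := by
    rw [hlam, Real.sqrt_le_iff, one_pow, div_le_one hM0]; exact ⟨zero_le_one, hM⟩
  have hlam2 : lam ^ 2 = V * 2 ^ i / M := Real.sq_sqrt (by positivity)
  set q : ℝ := (1 / 2) ^ i with hq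
  have hq0 : 0 < q := by positivity
  have hq2 : q * 2 ^ i = 1 := by rw [hq, ← mul_pow]; norm_num
  set t : ℝ := 3 * V + i with ht
  refine ⟨{x | YY μ (ee U G (v + i)) n lam q x < Real.exp t}, ?_, ?_, ?_⟩
  · exact measurableSet_lt (YY_measurable μ _ (ee_measurable hUm hG _) n lam q) measurable_const
  · have : {x | YY μ (ee U G (v + i)) n lam q x < Real.exp t}ᶜ =
        {x | Real.exp t ≤ YY μ (ee U G (v + i)) n lam q x} := by
      ext x; simp
    rw [this]
    refine (YY_tail μ (ee U G (v + i)) (ee_measurable hUm hG _) (ee_nonneg U G _)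
      (ee_sum_le U hU G _) (α / 2 ^ (v + i)) (hblk _) lam hlam0.le hlam1 n ?_ q hq0.le t).trans ?_
    · rw [hlam2, pow_add, ← hV]
      have : V * 2 ^ i / M * (α / (V * 2 ^ i)) * n = M / M := by
        rw [hMdef]; field_simp
      rw [this, div_self hM0.ne']
    · apply Real.exp_le_exp.mpr
      rw [Fintype.card_fin]
      push_cast
      rw [pow_add, ← hV, ht]
      have : 2 * q * (V * 2 ^ i) = 2 * V * (q * 2 ^ i) := by ring
      rw [this, hq2]; linarith
  · intro x hx a ha1 haV
    have hdet := YY_det μ (ee U G (v + i)) n lam q hq0 t x hx (fun b => |a b|)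
      (fun b => abs_nonneg _) (fun b => ha1 b b.2)
    have hsum : ∑ b : Fin (2 ^ (v + i)), |a b| ≤ V := by
      rw [Fin.sum_univ_eq_sum_range (fun b => |a b|)]; exact haV
    have hlogq : 1 - Real.log q ≤ 1 + i := by
      rw [hq, Real.log_pow]
      have h2 : Real.log (1 / 2) = - Real.log 2 := by rw [one_div, Real.log_inv]
      have h3 : Real.log 2 ≤ 1 := by linarith [Real.log_two_lt_d9]
      have hi : (0:ℝ) ≤ i := by positivity
      rw [h2]; nlinarith
    have hsum0 : 0 ≤ ∑ b : Fin (2 ^ (v + i)), |a b| := Finset.sum_nonneg fun b _ => abs_nonneg _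
    have hi : (0:ℝ) ≤ i := by positivity
    have h5 : (1 - Real.log q) * ∑ b : Fin (2 ^ (v + i)), |a b| ≤ (1 + i) * V :=
      (mul_le_mul_of_nonneg_right hlogq hsum0).trans
        (mul_le_mul_of_nonneg_left hsum (by positivity))
    have h6 : lam * ∑ b : Fin (2 ^ (v + i)), |a b| * |SS μ (ee U G (v + i)) n b x|
        ≤ V * (4 + 2 * i) := by
      refine hdet.trans ?_
      rw [ht]; nlinarith
    have hkey : lam * (Real.sqrt (M * V) * Real.sqrt (1 / 2) ^ i) = V := by
      have : Real.sqrt (1 / 2) ^ i = Real.sqrt q := by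
        rw [hq]
        have h : ((1:ℝ) / 2) ^ i = (Real.sqrt (1 / 2) ^ i) ^ 2 := by
          rw [← pow_mul, mul_comm, pow_mul, Real.sq_sqrt (by norm_num)]
        rw [h, Real.sqrt_sq (by positivity)]
      rw [this, hlam, ← Real.sqrt_mul (by positivity), ← Real.sqrt_mul (by positivity)]
      have h : V * 2 ^ i / M * (M * V * q) = V ^ 2 := by
        calc _ = V ^ 2 * (q * 2 ^ i) * (M / M) := by ring
          _ = _ := by rw [hq2, div_self hM0.ne']; ring
      rw [h, Real.sqrt_sq hVpos.le]
    refine le_of_mul_le_mul_left (h6.trans (le_of_eq ?_)) hlam0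
    linear_combination (-(4 + 2 * (i:ℝ))) * hkey

lemma sum_range_div_two (g : ℕ → ℝ) (m : ℕ) :
    ∑ b ∈ Finset.range (2 * m), g (b / 2) = 2 * ∑ b ∈ Finset.range m, g b := by
  induction m with
  | zero => simp
  | succ m ih =>
    rw [show 2 * (m + 1) = 2 * m + 1 + 1 by ring, Finset.sum_range_succ, Finset.sum_range_succ, ih,
      Finset.sum_range_succ, show 2 * m / 2 = m by omega, show (2 * m + 1) / 2 = m by omega]
    ring

/-- oscillation on a block -/
noncomputable def oscT (h1 h2 : ℝ → ℝ) (j b : ℕ) : ℝ :=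
  (h1 (((b + 1 : ℕ) : ℝ) / 2 ^ j) - h1 ((b : ℝ) / 2 ^ j)) +
    (h2 (((b + 1 : ℕ) : ℝ) / 2 ^ j) - h2 ((b : ℝ) / 2 ^ j))

lemma oscT_sum (h1 h2 : ℝ → ℝ) (j : ℕ) :
    ∑ b ∈ Finset.range (2 ^ j), oscT h1 h2 j b = (h1 1 - h1 0) + (h2 1 - h2 0) := by
  unfold oscT
  rw [Finset.sum_add_distrib, Finset.sum_range_sub (fun b : ℕ => h1 ((b:ℝ) / 2 ^ j)),
    Finset.sum_range_sub (fun b : ℕ => h2 ((b:ℝ) / 2 ^ j))]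
  simp

lemma osc_mono {h : ℝ → ℝ} (hh : MonotoneOn h (Set.Icc 0 1)) {A B s t : ℝ} (hA : 0 ≤ A) (hB : B ≤ 1)
    (hs : A ≤ s) (hs' : s ≤ B) (ht : A ≤ t) (ht' : t ≤ B) : h s - h t ≤ h B - h A := by
  have e1 := hh (show s ∈ Set.Icc (0:ℝ) 1 from ⟨by linarith, by linarith⟩)
    (show B ∈ Set.Icc (0:ℝ) 1 from ⟨by linarith, by linarith⟩) hs'
  have e2 := hh (show A ∈ Set.Icc (0:ℝ) 1 from ⟨by linarith, by linarith⟩)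
    (show t ∈ Set.Icc (0:ℝ) 1 from ⟨by linarith, by linarith⟩) ht
  linarith

lemma osc_bound {f h1 h2 : ℝ → ℝ} (hf : ∀ u ∈ Set.Ioo (0:ℝ) 1, f u = h1 u - h2 u)
    (m1 : MonotoneOn h1 (Set.Icc 0 1)) (m2 : MonotoneOn h2 (Set.Icc 0 1)) {j b : ℕ} (hb : b < 2 ^ j)
    {s t : ℝ} (hs : s ∈ Set.Ioo (0:ℝ) 1) (ht : t ∈ Set.Ioo (0:ℝ) 1)
    (hs1 : (b:ℝ) / 2 ^ j ≤ s) (hs2 : s ≤ ((b + 1 : ℕ) : ℝ) / 2 ^ j)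
    (ht1 : (b:ℝ) / 2 ^ j ≤ t) (ht2 : t ≤ ((b + 1 : ℕ) : ℝ) / 2 ^ j) :
    |f s - f t| ≤ oscT h1 h2 j b := by
  have hA : (0:ℝ) ≤ (b:ℝ) / 2 ^ j := by positivity
  have hB : ((b + 1 : ℕ) : ℝ) / 2 ^ j ≤ 1 := by
    rw [div_le_one (by positivity)]; exact_mod_cast hb
  rw [hf s hs, hf t ht]
  unfold oscT
  have a1 := osc_mono m1 hA hB hs1 hs2 ht1 ht2
  have a2 := osc_mono m1 hA hB ht1 ht2 hs1 hs2
  have a3 := osc_mono m2 hA hB hs1 hs2 ht1 ht2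
  have a4 := osc_mono m2 hA hB ht1 ht2 hs1 hs2
  rw [abs_le]; constructor <;> linarith

lemma oscT_nonneg {h1 h2 : ℝ → ℝ}
    (m1 : MonotoneOn h1 (Set.Icc 0 1)) (m2 : MonotoneOn h2 (Set.Icc 0 1)) {j b : ℕ} (hb : b < 2 ^ j) :
    0 ≤ oscT h1 h2 j b := by
  have hA : (0:ℝ) ≤ (b:ℝ) / 2 ^ j := by positivity
  have hB : ((b + 1 : ℕ) : ℝ) / 2 ^ j ≤ 1 := by
    rw [div_le_one (by positivity)]; exact_mod_cast hb
  have hAB : (b:ℝ) / 2 ^ j ≤ ((b + 1 : ℕ) : ℝ) / 2 ^ j := by gcongr; simp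
  unfold oscT
  have a1 := osc_mono m1 hA hB le_rfl hAB le_rfl hAB
  have a3 := osc_mono m2 hA hB le_rfl hAB le_rfl hAB
  linarith

/-- block centre -/
noncomputable def ctr (j b : ℕ) : ℝ := ((b:ℝ) + 1 / 2) / 2 ^ j

lemma ctr_ge (j b : ℕ) : (b:ℝ) / 2 ^ j ≤ ctr j b := by
  unfold ctr; gcongr; linarith

lemma ctr_le (j b : ℕ) : ctr j b ≤ ((b + 1 : ℕ) : ℝ) / 2 ^ j := by
  unfold ctr; gcongr; push_cast; linarith

lemma ctr_mem {j b : ℕ} (hb : b < 2 ^ j) : ctr j b ∈ Set.Ioo (0:ℝ) 1 := by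
  have hB : ((b + 1 : ℕ) : ℝ) ≤ 2 ^ j := by exact_mod_cast hb
  constructor
  · unfold ctr; positivity
  · unfold ctr
    rw [div_lt_one (by positivity)]
    push_cast at hB; linarith

lemma ctr_child_ge (j b : ℕ) : ((b / 2 : ℕ):ℝ) / 2 ^ j ≤ ctr (j + 1) b := by
  refine le_trans ?_ (ctr_ge (j + 1) b)
  rw [pow_succ, div_le_div_iff₀ (by positivity) (by positivity)]
  have : ((b / 2 : ℕ):ℝ) * 2 ≤ b := by exact_mod_cast Nat.div_mul_le_self b 2
  nlinarith [show (0:ℝ) < 2 ^ j by positivity]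

lemma ctr_child_le (j b : ℕ) : ctr (j + 1) b ≤ ((b / 2 + 1 : ℕ):ℝ) / 2 ^ j := by
  refine le_trans (ctr_le (j + 1) b) ?_
  rw [pow_succ, div_le_div_iff₀ (by positivity) (by positivity)]
  have : ((b + 1 : ℕ):ℝ) ≤ ((b / 2 + 1 : ℕ) : ℝ) * 2 := by
    have : b + 1 ≤ (b / 2 + 1) * 2 := by omega
    exact_mod_cast this
  nlinarith [show (0:ℝ) < 2 ^ j by positivity]

lemma floor_half (u : ℝ) (j : ℕ) : ⌊u * 2 ^ j⌋₊ = ⌊u * 2 ^ (j + 1)⌋₊ / 2 := by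
  rw [← Nat.floor_div_natCast]
  congr 1
  rw [pow_succ]; push_cast; ring

end Core


section Chain

variable {Ω : Type*} [MeasurableSpace Ω]

lemma nu_sub (μ : Measure Ω) (G : Set Ω) (n : ℕ) (φ ψ : Ω → ℝ)
    (hφ : Integrable (G.indicator φ) μ) (hψ : Integrable (G.indicator ψ) μ) (x : Fin n → Ω) :
    nu μ G n φ x - nu μ G n ψ x = nu μ G n (fun y => φ y - ψ y) x := by
  unfold nu
  rw [← Finset.sum_sub_distrib]
  have h : ∀ y, G.indicator (fun y => φ y - ψ y) y = G.indicator φ y - G.indicator ψ y := fun y => by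
    by_cases hy : y ∈ G <;> simp [hy]
  simp_rw [h]
  rw [integral_sub hφ hψ]
  refine Finset.sum_congr rfl fun i _ => ?_
  ring

lemma nu_abs_le (μ : Measure Ω) (G : Set Ω) (n : ℕ) (φ o : Ω → ℝ)
    (hφ : Integrable (G.indicator φ) μ) (ho : Integrable (G.indicator o) μ)
    (h : ∀ y, |φ y| ≤ o y) (x : Fin n → Ω) :
    |nu μ G n φ x| ≤ nu μ G n o x + 2 * n * ∫ y, G.indicator o y ∂μ := by
  have hp : ∀ y, |G.indicator φ y| ≤ G.indicator o y := fun y => by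
    by_cases hy : y ∈ G <;> simp [hy, h y]
  have hI : |∫ y, G.indicator φ y ∂μ| ≤ ∫ y, G.indicator o y ∂μ :=
    (abs_integral_le_integral_abs).trans (integral_mono hφ.abs ho hp)
  unfold nu
  have e : ∑ i, (G.indicator o (x i) - ∫ y, G.indicator o y ∂μ) + 2 * n * ∫ y, G.indicator o y ∂μ
      = ∑ i, (G.indicator o (x i) + ∫ y, G.indicator o y ∂μ) := by
    rw [Finset.sum_sub_distrib, Finset.sum_add_distrib]
    simp; ring
  rw [e]
  refine (Finset.abs_sum_le_sum_abs _ _).trans (Finset.sum_le_sum fun i _ => ?_)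
  refine (abs_sub _ _).trans ?_
  linarith [hp (x i)]

lemma block_integrable (μ : Measure Ω) [IsProbabilityMeasure μ] {U : Ω → ℝ} (hUm : Measurable U)
    (hU : ∀ y, U y ∈ Set.Ioo (0:ℝ) 1) {G : Set Ω} (hG : MeasurableSet G) (j : ℕ) (c : ℕ → ℝ) :
    Integrable (G.indicator (fun y => c ⌊U y * 2 ^ j⌋₊)) μ := by
  have : G.indicator (fun y => c ⌊U y * 2 ^ j⌋₊) = fun y => _ :=
    funext fun y => (ee_sum U hU G j c y).symm
  rw [this]
  exact integrable_finsetSum _ fun b _ => (ee_integrable μ hUm hG j b).const_mul _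

theorem core (μ : Measure Ω) [IsProbabilityMeasure μ] {U : Ω → ℝ} (hUm : Measurable U)
    (hU : ∀ y, U y ∈ Set.Ioo (0:ℝ) 1) {G : Set Ω} (hG : MeasurableSet G) (α : ℝ)
    (hblk : ∀ j b, ∫ y, ee U G j b y ∂μ ≤ α / 2 ^ j) (n v : ℕ)
    (hM : 4 * (2:ℝ) ^ v ≤ n * α) :
    ∃ E : Set (Fin n → Ω), MeasurableSet E ∧
      (Measure.pi fun _ : Fin n => μ).real Eᶜ ≤ 2 * Real.exp (-(2:ℝ) ^ v) ∧
      ∀ x ∈ E, ∀ f h1 h2 : ℝ → ℝ, (∀ u ∈ Set.Ioo (0:ℝ) 1, f u = h1 u - h2 u) →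
        (∀ u ∈ Set.Ioo (0:ℝ) 1, 0 ≤ f u ∧ f u ≤ 1) →
        MonotoneOn h1 (Set.Icc 0 1) → MonotoneOn h2 (Set.Icc 0 1) →
        2 * ((h1 1 - h1 0) + (h2 1 - h2 0)) ≤ 2 ^ v →
        Measurable (fun y => f (U y)) →
        |nu μ G n (fun y => f (U y)) x| ≤ 64 * Real.sqrt (n * α * 2 ^ v) := by
  set V : ℝ := 2 ^ v with hV
  set M : ℝ := n * α with hMdef
  have hVpos : 0 < V := by positivity
  have hM0 : 0 < M := by linarith
  -- choose the number of levels
  set s := Real.sqrt (M / V) with hs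
  have hs2 : s ^ 2 = M / V := Real.sq_sqrt (by positivity)
  have hs_ge : 2 ≤ s := by
    rw [hs]; apply Real.le_sqrt_of_sq_le
    rw [le_div_iff₀ hVpos]; linarith
  obtain ⟨m, hm1, hm2⟩ := exists_nat_pow_near (show 1 ≤ s by linarith) (show (1:ℝ) < 2 by norm_num)
  set I := m + 1 with hI
  have hIle : V * 2 ^ I ≤ M := by
    have : (2:ℝ) ^ I ≤ M / V := by
      rw [← hs2, hI, pow_succ]; nlinarith
    rw [le_div_iff₀ hVpos] at this; linarith
  have hlev : ∀ i : ℕ, i ≤ I → V * 2 ^ i ≤ M := fun i hi => by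
    refine le_trans ?_ hIle
    gcongr
    norm_num
  have hex : ∀ i : ℕ, ∃ E : Set (Fin n → Ω), i ≤ I → (MeasurableSet E ∧
      (Measure.pi fun _ : Fin n => μ).real Eᶜ ≤ Real.exp (-V - i) ∧
      ∀ x ∈ E, ∀ a : ℕ → ℝ, (∀ b < 2 ^ (v + i), |a b| ≤ 1) → (∑ b ∈ Finset.range (2 ^ (v + i)), |a b|) ≤ V →
        ∑ b : Fin (2 ^ (v + i)), |a b| * |SS μ (ee U G (v + i)) n b x| ≤
          Real.sqrt (M * V) * ((4 + 2 * (i:ℝ)) * Real.sqrt (1 / 2) ^ i)) := fun i => by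
    by_cases hi : i ≤ I
    · obtain ⟨E, h⟩ := level_event μ hUm hU hG α hblk n v i hM0 (hlev i hi)
      exact ⟨E, fun _ => h⟩
    · exact ⟨∅, fun h => absurd h hi⟩
  choose E hE using hex
  refine ⟨⋂ i ∈ Finset.range (I + 1), E i, ?_, ?_, ?_⟩
  · refine Finset.measurableSet_biInter _ fun i hi => (hE i ?_).1
    simp at hi; omega
  · have : (⋂ i ∈ Finset.range (I + 1), E i)ᶜ = ⋃ i ∈ Finset.range (I + 1), (E i)ᶜ := by
      simp [Set.compl_iInter]
    rw [this]
    refine (measureReal_biUnion_finset_le _ _).trans ?_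
    calc _ ≤ ∑ i ∈ Finset.range (I + 1), Real.exp (-V) * (1 / 2 : ℝ) ^ i := by
          refine Finset.sum_le_sum fun i hi => ?_
          refine (hE i (by simp at hi; omega)).2.1.trans ?_
          rw [sub_eq_add_neg, Real.exp_add]
          refine mul_le_mul_of_nonneg_left ?_ (Real.exp_pos _).le
          have h1 : Real.exp (-(i:ℝ)) = Real.exp (-1) ^ i := by
            rw [← Real.exp_nat_mul]; congr 1; ring
          rw [h1]
          refine pow_le_pow_left₀ (Real.exp_pos _).le ?_ _
          linarith [Real.exp_neg_one_lt_d9]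
      _ = Real.exp (-V) * ∑ i ∈ Finset.range (I + 1), (1 / 2 : ℝ) ^ i := by rw [Finset.mul_sum]
      _ ≤ Real.exp (-V) * 2 := mul_le_mul_of_nonneg_left (sum_geometric_two_le _) (Real.exp_pos _).le
      _ = _ := by ring
  · intro x hx f h1 h2 hf hf01 m1 m2 hvar hfm
    set R := (h1 1 - h1 0) + (h2 1 - h2 0) with hR
    set Z := Real.sqrt (M * V) with hZ
    have hZ0 : 0 ≤ Z := Real.sqrt_nonneg _
    set r := Real.sqrt (1 / 2) with hr
    have hr0 : 0 ≤ r := Real.sqrt_nonneg _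
    have hr1 : r ≤ 0.71 := sqrt_half_le
    have hxi : ∀ i ≤ I, x ∈ E i := fun i hi => by
      have := Set.mem_iInter₂.mp hx i (by simp; omega)
      exact this
    -- uniform bound on a block functional
    have hblockbd : ∀ i ≤ I, ∀ a : ℕ → ℝ, (∀ b < 2 ^ (v + i), |a b| ≤ 1) →
        (∑ b ∈ Finset.range (2 ^ (v + i)), |a b|) ≤ V →
        |nu μ G n (fun y => a ⌊U y * 2 ^ (v + i)⌋₊) x| ≤ Z * ((4 + 2 * (i:ℝ)) * r ^ i) := by
      intro i hi a ha1 haV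
      rw [nu_block μ hUm hU hG]
      refine (Finset.abs_sum_le_sum_abs _ _).trans ?_
      simp_rw [abs_mul]
      exact (hE i hi).2.2 x (hxi i hi) a ha1 haV
    have hRs : ∀ j, ∑ b ∈ Finset.range (2 ^ j), oscT h1 h2 j b = R := fun j => oscT_sum h1 h2 j
    have habs1 : ∀ s ∈ Set.Ioo (0:ℝ) 1, ∀ t ∈ Set.Ioo (0:ℝ) 1, |f s - f t| ≤ 1 := fun s hs t ht => by
      have := hf01 s hs; have := hf01 t ht
      rw [abs_le]; constructor <;> linarith
    have hchain : ∀ i ≤ I, |nu μ G n (fun y => f (ctr (v + i) ⌊U y * 2 ^ (v + i)⌋₊)) x| ≤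
        Z * ∑ k ∈ Finset.range (i + 1), (4 + 2 * (k:ℝ)) * r ^ k := by
      intro i
      induction i with
      | zero =>
        intro _
        have hb1 : ∀ b < 2 ^ (v + 0), |f (ctr (v + 0) b)| ≤ 1 := fun b hb => by
          have := hf01 _ (ctr_mem hb)
          rw [abs_le]; constructor <;> linarith
        have := hblockbd 0 (Nat.zero_le _) (fun b => f (ctr (v + 0) b)) hb1 (by
          refine (Finset.sum_le_sum fun b hb => hb1 b (Finset.mem_range.mp hb)).trans ?_
          simp [hV])
        simpa using this
      | succ i ih =>
        intro hi
        have ih' := ih (by omega)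
        set a : ℕ → ℝ := fun b => f (ctr (v + (i + 1)) b) - f (ctr (v + i) (b / 2)) with ha
        have hpar : ∀ b < 2 ^ (v + (i + 1)), b / 2 < 2 ^ (v + i) := fun b hb => by
          rw [← add_assoc, pow_succ] at hb; omega
        have ha1 : ∀ b < 2 ^ (v + (i + 1)), |a b| ≤ 1 := fun b hb =>
          habs1 _ (ctr_mem hb) _ (ctr_mem (hpar b hb))
        have haV : (∑ b ∈ Finset.range (2 ^ (v + (i + 1))), |a b|) ≤ V := by
          calc _ ≤ ∑ b ∈ Finset.range (2 ^ (v + (i + 1))), oscT h1 h2 (v + i) (b / 2) := by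
                refine Finset.sum_le_sum fun b hb => ?_
                have hb' := Finset.mem_range.mp hb
                exact osc_bound hf m1 m2 (hpar b hb') (ctr_mem hb') (ctr_mem (hpar b hb'))
                  (ctr_child_ge _ _) (ctr_child_le _ _) (ctr_ge _ _) (ctr_le _ _)
            _ = 2 * R := by
                rw [← hRs (v + i), ← sum_range_div_two, ← add_assoc, pow_succ, mul_comm]
            _ ≤ V := hvar
        have hstep := hblockbd (i + 1) hi a ha1 haV
        have hdiff : nu μ G n (fun y => f (ctr (v + (i + 1)) ⌊U y * 2 ^ (v + (i + 1))⌋₊)) x -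
            nu μ G n (fun y => f (ctr (v + i) ⌊U y * 2 ^ (v + i)⌋₊)) x =
            nu μ G n (fun y => a ⌊U y * 2 ^ (v + (i + 1))⌋₊) x := by
          rw [nu_sub]
          · congr 1
            funext y
            rw [floor_half (U y) (v + i)]
            rfl
          · exact block_integrable μ hUm hU hG _ (fun b => f (ctr (v + (i + 1)) b))
          · exact block_integrable μ hUm hU hG _ (fun b => f (ctr (v + i) b))
        rw [Finset.sum_range_succ, mul_add]
        rw [← hdiff] at hstep
        have := abs_le.mp hstep
        have := abs_le.mp ih'
        rw [abs_le]; constructor <;> linarith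
    have hI1 := hchain I le_rfl
    have hg := geo_sum_le hr0 hr1 (I + 1)
    -- remainder
    set o : ℕ → ℝ := fun b => min 1 (oscT h1 h2 (v + I) b) with ho
    have ho0 : ∀ b < 2 ^ (v + I), 0 ≤ o b := fun b hb => le_min zero_le_one (oscT_nonneg m1 m2 hb)
    have hosum : ∑ b ∈ Finset.range (2 ^ (v + I)), o b ≤ R := by
      rw [← hRs (v + I)]
      exact Finset.sum_le_sum fun b _ => min_le_right _ _
    have hR0 : 0 ≤ R := le_trans (Finset.sum_nonneg fun b hb => ho0 b (Finset.mem_range.mp hb)) hosum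
    have hoabs : ∑ b ∈ Finset.range (2 ^ (v + I)), |o b| ≤ V := by
      have : ∑ b ∈ Finset.range (2 ^ (v + I)), |o b| = ∑ b ∈ Finset.range (2 ^ (v + I)), o b :=
        Finset.sum_congr rfl fun b hb => abs_of_nonneg (ho0 b (Finset.mem_range.mp hb))
      rw [this]; linarith
    have hobd := hblockbd I le_rfl o (fun b hb => by
      rw [abs_of_nonneg (ho0 b hb)]; exact min_le_left _ _) hoabs
    have hlast : (4 + 2 * (I:ℝ)) * r ^ I ≤ 31 := by
      refine le_trans ?_ hg
      exact Finset.single_le_sum (f := fun k : ℕ => (4 + 2 * (k:ℝ)) * r ^ k)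
        (fun k _ => by positivity) (Finset.mem_range.mpr (Nat.lt_succ_self I))
    have hoint := block_integrable μ hUm hU hG (v + I) o
    have hcint := block_integrable μ hUm hU hG (v + I) (fun b => f (ctr (v + I) b))
    have hfint : Integrable (G.indicator (fun y => f (U y))) μ := by
      refine Integrable.indicator ?_ hG
      refine Integrable.of_bound hfm.aestronglyMeasurable 1 (Filter.Eventually.of_forall fun y => ?_)
      have := hf01 _ (hU y)
      rw [Real.norm_eq_abs, abs_of_nonneg this.1]; exact this.2
    have hdint : Integrable (G.indicator (fun y => f (U y) - f (ctr (v + I) ⌊U y * 2 ^ (v + I)⌋₊))) μ := by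
      have : G.indicator (fun y => f (U y) - f (ctr (v + I) ⌊U y * 2 ^ (v + I)⌋₊)) =
          fun y => G.indicator (fun y => f (U y)) y -
            G.indicator (fun y => f (ctr (v + I) ⌊U y * 2 ^ (v + I)⌋₊)) y := by
        funext y
        by_cases hy : y ∈ G <;> simp [hy]
      rw [this]; exact hfint.sub hcint
    have hrem := nu_abs_le μ G n _ (fun y => o ⌊U y * 2 ^ (v + I)⌋₊) hdint hoint (fun y => by
      have hb := floor_lt (hU y) (v + I)
      have hu0 : 0 ≤ U y * 2 ^ (v + I) := by have := (hU y).1; positivity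
      refine le_min (habs1 _ (hU y) _ (ctr_mem hb)) ?_
      refine osc_bound hf m1 m2 hb (hU y) (ctr_mem hb) ?_ ?_ (ctr_ge _ _) (ctr_le _ _)
      · rw [div_le_iff₀ (by positivity)]; exact Nat.floor_le hu0
      · rw [le_div_iff₀ (by positivity)]; push_cast; exact (Nat.lt_floor_add_one _).le) x
    rw [← nu_sub μ G n _ _ hfint hcint] at hrem
    have hint : 2 * n * ∫ y, G.indicator (fun y => o ⌊U y * 2 ^ (v + I)⌋₊) y ∂μ ≤ Z := by
      rw [integral_block μ hUm hU hG]
      have hα : (0:ℝ) ≤ α / 2 ^ (v + I) :=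
        (integral_nonneg fun y => ee_nonneg U G (v + I) ⟨0, by positivity⟩ y).trans
          (hblk (v + I) ⟨0, by positivity⟩)
      have hle : ∑ b : Fin (2 ^ (v + I)), o b * ∫ y, ee U G (v + I) b y ∂μ ≤
          R * (α / 2 ^ (v + I)) := by
        calc _ ≤ ∑ b : Fin (2 ^ (v + I)), o b * (α / 2 ^ (v + I)) :=
              Finset.sum_le_sum fun b _ => mul_le_mul_of_nonneg_left (hblk _ b) (ho0 b b.2)
          _ = (∑ b ∈ Finset.range (2 ^ (v + I)), o b) * (α / 2 ^ (v + I)) := by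
              rw [Finset.sum_mul, Fin.sum_univ_eq_sum_range (fun b => o b * (α / 2 ^ (v + I)))]
          _ ≤ _ := mul_le_mul_of_nonneg_right hosum hα
      have hn0 : (0:ℝ) ≤ 2 * n := by positivity
      calc _ ≤ 2 * n * (R * (α / 2 ^ (v + I))) := mul_le_mul_of_nonneg_left hle hn0
        _ = (2 * R) * M / (V * 2 ^ I) := by rw [pow_add, hMdef, hV]; ring
        _ ≤ V * M / (V * 2 ^ I) := by gcongr
        _ = M / 2 ^ I := by field_simp
        _ ≤ Z := by
            rw [div_le_iff₀ (by positivity)]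
            have hZs : Z * s = M := by
              rw [hZ, hs, ← Real.sqrt_mul (by positivity)]
              have : M * V * (M / V) = M ^ 2 := by field_simp
              rw [this, Real.sqrt_sq hM0.le]
            calc M = Z * s := hZs.symm
              _ ≤ Z * 2 ^ I := mul_le_mul_of_nonneg_left hm2.le hZ0
    have k1 : Z * ∑ k ∈ Finset.range (I + 1), (4 + 2 * (k:ℝ)) * r ^ k ≤ Z * 31 :=
      mul_le_mul_of_nonneg_left hg hZ0
    have k2 : Z * ((4 + 2 * (I:ℝ)) * r ^ I) ≤ Z * 31 := mul_le_mul_of_nonneg_left hlast hZ0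
    have a1 := abs_le.mp hI1
    have a2 := (abs_le.mp hobd).2
    have a3 := abs_le.mp hrem
    rw [abs_le]; constructor <;> linarith

end Chain


section Final
open ProbabilityTheory

lemma prob_ge {Ω : Type*} [MeasurableSpace Ω] (P : Measure Ω) [IsProbabilityMeasure P] (E : Set Ω)
    (δ : ℝ) (h : P.real Eᶜ ≤ δ) : ENNReal.ofReal (1 - δ) ≤ P E := by
  have h1 : P.real (E ∪ Eᶜ) ≤ P.real E + P.real Eᶜ := measureReal_union_le _ _
  rw [Set.union_compl_self, probReal_univ] at h1
  rw [← ofReal_measureReal]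
  exact ENNReal.ofReal_le_ofReal (by linarith)

lemma measure_split {g : ℕ} {X : Type*} [MeasurableSpace X] (m : Measure (X × Fin g))
    (s : Set (X × Fin g)) (hs : MeasurableSet s) :
    m s = ∑ ℓ, m ({p | (p, ℓ) ∈ s} ×ˢ ({ℓ} : Set (Fin g))) := by
  have hA : ∀ ℓ : Fin g, MeasurableSet {p : X | (p, ℓ) ∈ s} := fun ℓ =>
    measurable_prodMk_right hs
  rw [← measure_biUnion_finset]
  · congr 1
    ext ⟨p, ℓ⟩
    simp
  · intro a _ b _ hab
    rw [Function.onFun, Set.disjoint_left]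
    rintro ⟨p, ℓ⟩ h1 h2
    simp only [Set.mem_prod, Set.mem_singleton_iff] at h1 h2
    exact hab (h1.2.symm.trans h2.2)
  · intro ℓ _
    exact (hA ℓ).prod (measurableSet_singleton _)

lemma meas_label {g : ℕ} {X : Type*} [MeasurableSpace X] (F : Fin g → X → ℝ)
    (hF : ∀ ℓ, Measurable (F ℓ)) : Measurable (fun y : X × Fin g => F y.2 y.1) :=
  measurable_from_prod_countable_left hF

lemma transfer {g : ℕ} (D : Measure (ℝ × Fin g)) [IsProbabilityMeasure D]
    (hpos : ∀ ℓ : Fin g, D (Set.univ ×ˢ ({ℓ} : Set (Fin g))) ≠ 0) :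
    ∃ Q : Fin g → Set.Ioo (0:ℝ) 1 → ℝ, (∀ ℓ, Monotone (Q ℓ)) ∧
      (lamI.prod (D.map Prod.snd)).map (fun y => (Q y.2 y.1, y.2)) = D := by
  have hlam := vol_Ioo_prob
  have hB : ∀ ℓ : Fin g, MeasurableSet (Set.univ ×ˢ ({ℓ} : Set (Fin g)) : Set (ℝ × Fin g)) :=
    fun ℓ => MeasurableSet.univ.prod (measurableSet_singleton _)
  have hq : ∀ ℓ : Fin g, ∃ Q : Set.Ioo (0:ℝ) 1 → ℝ, Monotone Q ∧
      lamI.map Q = (cond D (Set.univ ×ˢ ({ℓ} : Set (Fin g)))).map Prod.fst := fun ℓ => by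
    have := cond_isProbabilityMeasure (hpos ℓ)
    have : IsProbabilityMeasure ((cond D (Set.univ ×ˢ ({ℓ} : Set (Fin g)))).map Prod.fst) :=
      Measure.isProbabilityMeasure_map measurable_fst.aemeasurable
    exact exists_quantile _
  choose Q hQm hQ using hq
  refine ⟨Q, hQm, ?_⟩
  have hφ : Measurable (fun y : Set.Ioo (0:ℝ) 1 × Fin g => (Q y.2 y.1, y.2)) :=
    (meas_label Q fun ℓ => (hQm ℓ).measurable).prodMk measurable_snd
  have : IsProbabilityMeasure (D.map Prod.snd) :=
    Measure.isProbabilityMeasure_map measurable_snd.aemeasurable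
  ext s hs
  rw [measure_split _ s hs, measure_split D s hs]
  refine Finset.sum_congr rfl fun ℓ _ => ?_
  have hA : MeasurableSet {p : ℝ | (p, ℓ) ∈ s} := measurable_prodMk_right hs
  set A := {p : ℝ | (p, ℓ) ∈ s} with hAdef
  rw [Measure.map_apply hφ (hA.prod (measurableSet_singleton _))]
  have hpre : (fun y : Set.Ioo (0:ℝ) 1 × Fin g => (Q y.2 y.1, y.2)) ⁻¹' (A ×ˢ {ℓ}) =
      (Q ℓ ⁻¹' A) ×ˢ {ℓ} := by
    ext ⟨u, k⟩
    simp only [Set.mem_preimage, Set.mem_prod, Set.mem_singleton_iff]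
    constructor
    · rintro ⟨h1, rfl⟩; exact ⟨h1, rfl⟩
    · rintro ⟨h1, rfl⟩; exact ⟨h1, rfl⟩
  rw [hpre, Measure.prod_prod, ← Measure.map_apply (hQm ℓ).measurable hA, hQ ℓ,
    Measure.map_apply measurable_fst hA, cond_apply (hB ℓ),
    Measure.map_apply measurable_snd (measurableSet_singleton _)]
  have e1 : (Prod.snd ⁻¹' {ℓ} : Set (ℝ × Fin g)) = Set.univ ×ˢ {ℓ} := by ext ⟨p, k⟩; simp
  have e2 : (Set.univ ×ˢ {ℓ} ∩ Prod.fst ⁻¹' A : Set (ℝ × Fin g)) = A ×ˢ {ℓ} := by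
    ext ⟨p, k⟩; simp [and_comm]
  rw [e1, e2, mul_comm, ← mul_assoc, ENNReal.mul_inv_cancel (hpos ℓ) (measure_ne_top _ _), one_mul]

/-- extension to the closed interval -/
noncomputable def extI (lo hi : ℝ) (H : Set.Ioo (0:ℝ) 1 → ℝ) (u : ℝ) : ℝ :=
  if h : u ∈ Set.Ioo (0:ℝ) 1 then H ⟨u, h⟩ else if u ≤ 0 then lo else hi

lemma extI_of_mem (lo hi : ℝ) (H : Set.Ioo (0:ℝ) 1 → ℝ) (u : Set.Ioo (0:ℝ) 1) :
    extI lo hi H u = H u := by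
  unfold extI; rw [dif_pos u.2]

lemma extI_zero (lo hi : ℝ) (H : Set.Ioo (0:ℝ) 1 → ℝ) : extI lo hi H 0 = lo := by
  simp [extI]

lemma extI_one (lo hi : ℝ) (H : Set.Ioo (0:ℝ) 1 → ℝ) : extI lo hi H 1 = hi := by
  unfold extI; rw [dif_neg (by simp), if_neg (by norm_num)]

lemma extI_mono {lo hi : ℝ} {H : Set.Ioo (0:ℝ) 1 → ℝ} (hH : Monotone H) (hlo : ∀ u, lo ≤ H u)
    (hhi : ∀ u, H u ≤ hi) (hlh : lo ≤ hi) : MonotoneOn (extI lo hi H) (Set.Icc 0 1) := by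
  intro u hu w hw huw
  rcases hu.1.eq_or_lt with rfl | hu0
  · rw [extI_zero]
    unfold extI
    split_ifs
    · exact hlo _
    · exact le_rfl
    · exact hlh
  rcases hw.2.eq_or_lt with rfl | hw1
  · rw [extI_one]
    unfold extI
    split_ifs
    · exact hhi _
    · exact hlh
    · exact le_rfl
  have hu' : u ∈ Set.Ioo (0:ℝ) 1 := ⟨hu0, huw.trans_lt hw1⟩
  have hw' : w ∈ Set.Ioo (0:ℝ) 1 := ⟨hu0.trans_le huw, hw1⟩
  have e1 := extI_of_mem lo hi H ⟨u, hu'⟩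
  have e2 := extI_of_mem lo hi H ⟨w, hw'⟩
  simp only at e1 e2
  rw [e1, e2]
  exact hH huw

lemma lamI_block (j b : ℕ) : lamI.real {u : Set.Ioo (0:ℝ) 1 | ⌊(u:ℝ) * 2 ^ j⌋₊ = b} ≤ 1 / 2 ^ j := by
  rw [Measure.real, lamI_apply]
  refine ENNReal.toReal_le_of_le_ofReal (by positivity) ?_
  calc _ ≤ volume (Set.Icc ((b:ℝ) / 2 ^ j) (((b:ℝ) + 1) / 2 ^ j)) := by
        refine measure_mono ?_
        rintro _ ⟨u, hu, rfl⟩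
        have hu0 : 0 ≤ (u:ℝ) * 2 ^ j := by have := u.2.1; positivity
        simp only [Set.mem_setOf_eq] at hu
        constructor
        · rw [div_le_iff₀ (by positivity), ← hu]; exact Nat.floor_le hu0
        · rw [le_div_iff₀ (by positivity), ← hu]; exact (Nat.lt_floor_add_one _).le
    _ = _ := by rw [Real.volume_Icc]; congr 1; ring

/-- final arithmetic -/
lemma ratio_bound {A N a α n M Z Δ : ℝ} (hα : 0 < α) (hM : M = n * α) (hM0 : 0 < M) (hΔ : 0 < Δ)
    (hA0 : 0 ≤ A) (hAN : A ≤ Δ * N)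
    (h1 : |A - n * a| ≤ Δ * Z) (h2 : |N - M| ≤ Z) (hZ : Z < M) :
    0 < N ∧ |A / N - a / α| ≤ 2 * Δ * Z / M := by
  have hN : 0 < N := by have := (abs_le.mp h2).1; linarith
  refine ⟨hN, ?_⟩
  have hn : n ≠ 0 := by rintro rfl; simp at hM; linarith
  have e : A / N - a / α = ((A - n * a) + (A / N) * (M - N)) / M := by
    rw [hM]; field_simp; ring
  have hAN' : A / N ≤ Δ := by rw [div_le_iff₀ hN]; exact hAN
  have hAN0 : 0 ≤ A / N := by positivity
  rw [e, abs_div, abs_of_pos hM0]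
  gcongr
  calc |A - n * a + A / N * (M - N)| ≤ |A - n * a| + |A / N * (M - N)| := abs_add_le _ _
    _ ≤ Δ * Z + Δ * Z := by
        rw [abs_mul, abs_of_nonneg hAN0, abs_sub_comm M N]
        gcongr
    _ = _ := by ring

lemma sum_ite_bounds {g n : ℕ} {Δ : ℝ} (hΔ : 0 < Δ) (x : Fin n → ℝ × Fin g) (T : Finset ℝ) (ℓ : Fin g) :
    0 ≤ (∑ i, if (x i).2 = ℓ then imp Δ (x i).1 T else 0) ∧
    (∑ i, if (x i).2 = ℓ then imp Δ (x i).1 T else 0) ≤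
      Δ * ((Finset.univ.filter (fun i : Fin n => (x i).2 = ℓ)).card : ℝ) := by
  constructor
  · refine Finset.sum_nonneg fun i _ => ?_
    split_ifs
    · exact imp_nonneg _ _ _
    · exact le_rfl
  · rw [← Finset.sum_filter]
    refine (Finset.sum_le_card_nsmul _ _ Δ fun i _ => imp_le hΔ.le _ _).trans ?_
    rw [nsmul_eq_mul, mul_comm]

lemma imp_joint_meas {g : ℕ} {Δ : ℝ} (hΔ : 0 < Δ) (T : Finset ℝ) (ℓ : Fin g) :
    Measurable (fun x : ℝ × Fin g => if x.2 = ℓ then imp Δ x.1 T else 0) := by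
  refine Measurable.ite ?_ ((imp_measurable hΔ T).comp measurable_fst) measurable_const
  exact measurable_snd (measurableSet_singleton ℓ)

/-- trivial regime -/
lemma case_trivial {g : ℕ} {Δ : ℝ} (hΔ : 0 < Δ) (D : Measure (ℝ × Fin g)) [IsProbabilityMeasure D]
    (α : Fin g → ℝ) (hα : α = fun ℓ => (D (Set.univ ×ˢ ({ℓ} : Set (Fin g)))).toReal)
    (hpos : ∀ ℓ, 0 < α ℓ) (n : ℕ) (x : Fin n → ℝ × Fin g) (ℓ : Fin g)
    (hx : ∃ i, (x i).2 = ℓ) (T : Finset ℝ) :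
    |(∑ i, if (x i).2 = ℓ then imp Δ (x i).1 T else 0) /
        ((Finset.univ.filter (fun i : Fin n => (x i).2 = ℓ)).card : ℝ) -
      (∫ x, (if x.2 = ℓ then imp Δ x.1 T else 0) ∂D) / α ℓ| ≤ Δ := by
  obtain ⟨s0, s1⟩ := sum_ite_bounds hΔ x T ℓ
  have hN : (0:ℝ) < ((Finset.univ.filter (fun i : Fin n => (x i).2 = ℓ)).card : ℝ) := by
    obtain ⟨i, hi⟩ := hx
    exact_mod_cast Finset.card_pos.mpr ⟨i, by simp [hi]⟩
  have hB : MeasurableSet (Set.univ ×ˢ ({ℓ} : Set (Fin g)) : Set (ℝ × Fin g)) :=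
    MeasurableSet.univ.prod (measurableSet_singleton _)
  have i0 : 0 ≤ ∫ x, (if x.2 = ℓ then imp Δ x.1 T else 0) ∂D := by
    refine integral_nonneg fun x => ?_
    simp only [Pi.zero_apply]
    split_ifs
    · exact imp_nonneg _ _ _
    · exact le_rfl
  have i1 : ∫ x, (if x.2 = ℓ then imp Δ x.1 T else 0) ∂D ≤ Δ * α ℓ := by
    have : Δ * α ℓ = ∫ x, (Set.univ ×ˢ ({ℓ} : Set (Fin g)) : Set (ℝ × Fin g)).indicator (fun _ => Δ) x ∂D := by
      rw [integral_indicator_const _ hB, smul_eq_mul, mul_comm, hα]; rfl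
    rw [this]
    refine integral_mono ?_ ((integrable_const Δ).indicator hB) fun x => ?_
    · refine Integrable.of_bound (imp_joint_meas hΔ T ℓ).aestronglyMeasurable Δ
        (Filter.Eventually.of_forall fun x => ?_)
      split_ifs
      · rw [Real.norm_eq_abs, abs_of_nonneg (imp_nonneg _ _ _)]; exact imp_le hΔ.le _ _
      · simpa using hΔ.le
    · by_cases h : x.2 = ℓ
      · simp [h, Set.indicator, imp_le hΔ.le]
      · simp [h, Set.indicator]
  have a1 : 0 ≤ (∑ i, if (x i).2 = ℓ then imp Δ (x i).1 T else 0) /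
        ((Finset.univ.filter (fun i : Fin n => (x i).2 = ℓ)).card : ℝ) := by positivity
  have a2 : (∑ i, if (x i).2 = ℓ then imp Δ (x i).1 T else 0) /
        ((Finset.univ.filter (fun i : Fin n => (x i).2 = ℓ)).card : ℝ) ≤ Δ := by
    rw [div_le_iff₀ hN]; exact s1
  have a3 : 0 ≤ (∫ x, (if x.2 = ℓ then imp Δ x.1 T else 0) ∂D) / α ℓ := div_nonneg i0 (hpos ℓ).le
  have a4 : (∫ x, (if x.2 = ℓ then imp Δ x.1 T else 0) ∂D) / α ℓ ≤ Δ := by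
    rw [div_le_iff₀ (hpos ℓ)]; exact i1
  rw [abs_le]; constructor <;> linarith

lemma miss_prob {g : ℕ} (D : Measure (ℝ × Fin g)) [IsProbabilityMeasure D]
    (n : ℕ) (ℓ : Fin g) :
    (Measure.pi fun _ : Fin n => D).real {x | ∀ i, (x i).2 ≠ ℓ} ≤
      Real.exp (-(n * (D (Set.univ ×ˢ ({ℓ} : Set (Fin g)))).toReal)) := by
  have hB : MeasurableSet (Set.univ ×ˢ ({ℓ} : Set (Fin g)) : Set (ℝ × Fin g)) :=
    MeasurableSet.univ.prod (measurableSet_singleton _)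
  have e : {x : Fin n → ℝ × Fin g | ∀ i, (x i).2 ≠ ℓ} =
      Set.univ.pi fun _ => (Set.univ ×ˢ ({ℓ} : Set (Fin g)) : Set (ℝ × Fin g))ᶜ := by
    ext x; simp [Set.mem_pi]
  rw [e, Measure.real, Measure.pi_pi]
  simp only [Finset.prod_const, Finset.card_univ, Fintype.card_fin, ENNReal.toReal_pow]
  have : (D (Set.univ ×ˢ ({ℓ} : Set (Fin g)))ᶜ).toReal = 1 - (D (Set.univ ×ˢ ({ℓ} : Set (Fin g)))).toReal :=
    probReal_compl_eq_one_sub hB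
  rw [this, ← mul_neg, Real.exp_nat_mul]
  refine pow_le_pow_left₀ ?_ ?_ _
  · rw [← this]; exact ENNReal.toReal_nonneg
  · linarith [Real.add_one_le_exp (-(D (Set.univ ×ˢ ({ℓ} : Set (Fin g)))).toReal)]

end Final


section Assembly

lemma group_event {g : ℕ} (D : Measure (ℝ × Fin g)) [IsProbabilityMeasure D]
    (Q : Fin g → Set.Ioo (0:ℝ) 1 → ℝ) (hQm : ∀ ℓ, Monotone (Q ℓ))
    (hQ : (lamI.prod (D.map Prod.snd)).map (fun y => (Q y.2 y.1, y.2)) = D)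
    {Δ : ℝ} (hΔ : 0 < Δ) (ℓ : Fin g) (α : ℝ)
    (hα : α = (D (Set.univ ×ˢ ({ℓ} : Set (Fin g)))).toReal) (n k v : ℕ) (hk1 : 1 ≤ k)
    (hk : 10 * (k:ℝ) ≤ 2 ^ v) (hM : 4 * (2:ℝ) ^ v ≤ n * α) :
    ∃ E : Set (Fin n → Set.Ioo (0:ℝ) 1 × Fin g), MeasurableSet E ∧
      (Measure.pi fun _ : Fin n => lamI.prod (D.map Prod.snd)).real Eᶜ ≤ 2 * Real.exp (-(2:ℝ) ^ v) ∧
      ∀ x ∈ E,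
        |((Finset.univ.filter (fun i : Fin n => (x i).2 = ℓ)).card : ℝ) - n * α| ≤
            64 * Real.sqrt (n * α * 2 ^ v) ∧
        ∀ T : Finset ℝ, T.card ≤ k →
          |(∑ i, if (x i).2 = ℓ then imp Δ (Q (x i).2 (x i).1) T else 0) -
            n * ∫ y, (if y.2 = ℓ then imp Δ y.1 T else 0) ∂D| ≤
            Δ * (64 * Real.sqrt (n * α * 2 ^ v)) := by
  have hlam := vol_Ioo_prob
  have hsnd : IsProbabilityMeasure (D.map Prod.snd) :=
    Measure.isProbabilityMeasure_map measurable_snd.aemeasurable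
  have hφ : Measurable (fun y : Set.Ioo (0:ℝ) 1 × Fin g => (Q y.2 y.1, y.2)) :=
    (meas_label Q fun ℓ => (hQm ℓ).measurable).prodMk measurable_snd
  set D' := lamI.prod (D.map Prod.snd) with hD'
  let G : Set (Set.Ioo (0:ℝ) 1 × Fin g) := {y | y.2 = ℓ}
  let U : Set.Ioo (0:ℝ) 1 × Fin g → ℝ := fun y => y.1
  have hG : MeasurableSet G := measurable_snd (measurableSet_singleton ℓ)
  have hUm : Measurable U := measurable_subtype_coe.comp measurable_fst
  have hU : ∀ y, U y ∈ Set.Ioo (0:ℝ) 1 := fun y => y.1.2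
  have hαl : (D.map Prod.snd).real {ℓ} = α := by
    rw [Measure.real, Measure.map_apply measurable_snd (measurableSet_singleton _), hα]
    congr 2
    ext ⟨p, k⟩; simp
  have hα0 : 0 ≤ α := by rw [← hαl]; exact measureReal_nonneg
  have hblk : ∀ j b, ∫ y, ee U G j b y ∂D' ≤ α / 2 ^ j := by
    intro j b
    have e : (G ∩ {y | ⌊U y * 2 ^ j⌋₊ = (b : ℕ)}) =
        {u : Set.Ioo (0:ℝ) 1 | ⌊(u:ℝ) * 2 ^ j⌋₊ = (b:ℕ)} ×ˢ {ℓ} := by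
      ext ⟨u, m⟩
      simp [G, U, and_comm]
    have hm : MeasurableSet (G ∩ {y | ⌊U y * 2 ^ j⌋₊ = (b : ℕ)}) := by
      refine hG.inter ?_
      exact (Nat.measurable_floor.comp (hUm.mul_const _)) (measurableSet_singleton (b:ℕ))
    have : ∫ y, ee U G j b y ∂D' = D'.real (G ∩ {y | ⌊U y * 2 ^ j⌋₊ = (b : ℕ)}) := by
      have h := integral_indicator_const (μ := D') (1:ℝ) hm
      simp only [smul_eq_mul, mul_one] at h
      rw [← h]; rfl
    rw [this, e, hD', measureReal_prod_prod, hαl]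
    calc _ ≤ (1 / 2 ^ j) * α := by gcongr; exact lamI_block j b
      _ = _ := by ring
  obtain ⟨E, hE, hEp, hEx⟩ := core D' hUm hU hG α hblk n v hM
  refine ⟨E, hE, hEp, fun x hx => ⟨?_, fun T hT => ?_⟩⟩
  · have h := hEx x hx (fun _ => 1) (fun _ => 1) (fun _ => 0) (by simp) (by simp)
      monotoneOn_const monotoneOn_const (by simp) measurable_const
    have e : nu D' G n (fun y => (1:ℝ)) x =
        ((Finset.univ.filter (fun i : Fin n => (x i).2 = ℓ)).card : ℝ) - n * α := by
      have h1 : ∫ y, G.indicator (fun _ => (1:ℝ)) y ∂D' = α := by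
        rw [integral_indicator_const _ hG, smul_eq_mul, mul_one]
        have : G = Set.univ ×ˢ {ℓ} := by ext ⟨u, m⟩; simp [G]
        rw [this, hD', measureReal_prod_prod, hαl]; simp
      unfold nu
      rw [Finset.sum_sub_distrib, h1]
      simp [Set.indicator, G]
    rw [e] at h
    exact h
  · have hTk : (T.card : ℝ) ≤ k := by exact_mod_cast hT
    have hk1' : (1:ℝ) ≤ k := by exact_mod_cast hk1
    let F : Set.Ioo (0:ℝ) 1 → ℝ := fun u => imp Δ (Q ℓ u) T / Δ
    have hF0 : ∀ u, 0 ≤ F u := fun u => div_nonneg (imp_nonneg _ _ _) hΔ.le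
    have hF1 : ∀ u, F u ≤ 1 := fun u => by
      rw [div_le_one hΔ]; exact imp_le hΔ.le _ _
    have hc : ∀ p, cntT Δ T p ≤ 2 * k := fun p => (cntT_le Δ T p).trans (by linarith)
    have efy : ∀ y : Set.Ioo (0:ℝ) 1 × Fin g, extI 0 0 F (U y) = F y.1 := fun y =>
      extI_of_mem 0 0 F y.1
    have h := hEx x hx (extI 0 0 F) (extI 0 (2 * k) fun u => cntT Δ T (Q ℓ u))
      (extI (-1) (2 * k) fun u => impR Δ T (Q ℓ u))
      (by
        intro u hu
        have e1 := extI_of_mem 0 0 F ⟨u, hu⟩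
        have e2 := extI_of_mem 0 (2 * k) (fun u => cntT Δ T (Q ℓ u)) ⟨u, hu⟩
        have e3 := extI_of_mem (-1) (2 * k) (fun u => impR Δ T (Q ℓ u)) ⟨u, hu⟩
        simp only at e1 e2 e3
        rw [e1, e2, e3]
        simp only [F, impR]; ring)
      (by
        intro u hu
        have e1 := extI_of_mem 0 0 F ⟨u, hu⟩
        simp only at e1
        rw [e1]
        exact ⟨hF0 _, hF1 _⟩)
      (extI_mono ((cntT_mono Δ T).comp (hQm ℓ)) (fun u => cntT_nonneg _ _ _) (fun u => hc _)
        (by positivity))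
      (extI_mono ((impR_mono hΔ T).comp (hQm ℓ))
        (fun u => by
          have := hF1 u
          have := cntT_nonneg Δ T (Q ℓ u)
          simp only [F, impR] at *
          linarith)
        (fun u => by
          have := hF0 u
          have := hc (Q ℓ u)
          simp only [F, impR] at *
          linarith)
        (by linarith))
      (by rw [extI_zero, extI_zero, extI_one, extI_one]; linarith)
      (by
        simp only [efy, F]
        exact (((imp_measurable hΔ T).comp (hQm ℓ).measurable).div_const _).comp measurable_fst)
    have hind : ∀ y, G.indicator (fun y => extI 0 0 F (U y)) y =
        (if y.2 = ℓ then imp Δ (Q y.2 y.1) T else 0) / Δ := by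
      intro y
      by_cases hy : y.2 = ℓ
      · have : y ∈ G := hy
        rw [Set.indicator_of_mem this, if_pos hy, efy, hy]
      · have : y ∉ G := hy
        rw [Set.indicator_of_notMem this, if_neg hy, zero_div]
    have hint : ∫ y, G.indicator (fun y => extI 0 0 F (U y)) y ∂D' =
        (∫ y, (if y.2 = ℓ then imp Δ y.1 T else 0) ∂D) / Δ := by
      simp only [hind]
      rw [integral_div]
      congr 1
      conv_rhs => rw [← hQ]
      rw [integral_map hφ.aemeasurable (imp_joint_meas hΔ T ℓ).aestronglyMeasurable]
    have e : nu D' G n (fun y => extI 0 0 F (U y)) x =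
        ((∑ i, if (x i).2 = ℓ then imp Δ (Q (x i).2 (x i).1) T else 0) -
            n * ∫ y, (if y.2 = ℓ then imp Δ y.1 T else 0) ∂D) / Δ := by
      unfold nu
      rw [Finset.sum_sub_distrib, hint]
      simp only [hind]
      rw [← Finset.sum_div, Finset.sum_const, Finset.card_univ, Fintype.card_fin, nsmul_eq_mul]
      ring
    rw [e, abs_div, abs_of_pos hΔ, div_le_iff₀ hΔ] at h
    linarith

/-- numeric choices -/
lemma numeric {Δ ε L M : ℝ} {k : ℕ} (hk : 1 ≤ k) (hε : 0 < ε) (hΔ : 1024 * ε < Δ)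
    (hL : 0.69 ≤ L) (hM : 2 * (ε⁻¹ ^ 2 * Δ ^ 2 * ((k : ℝ) * Real.log k + L) + 4 * L) ≤ M) :
    ∃ v : ℕ, 10 * (k:ℝ) ≤ 2 ^ v ∧ L ≤ 2 ^ v ∧ 4 * (2:ℝ) ^ v ≤ M ∧ 0 < M ∧
      64 * Real.sqrt (M * 2 ^ v) < M ∧ 2 * Δ * (64 * Real.sqrt (M * 2 ^ v)) / M ≤ 1024 * ε := by
  have hk' : (1:ℝ) ≤ k := by exact_mod_cast hk
  obtain ⟨m, hm1, hm2⟩ := exists_nat_pow_near (x := 10 * (k:ℝ) + L) (by linarith) (y := 2) (by norm_num)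
  set V : ℝ := 2 ^ (m + 1) with hV
  have hV2 : V ≤ 2 * (10 * k + L) := by rw [hV, pow_succ]; linarith
  have hlog : 0 ≤ (k:ℝ) * Real.log k := by have := Real.log_nonneg hk'; positivity
  set K := (k : ℝ) * Real.log k + L with hK
  have hkK : (k:ℝ) ≤ 1.5 * K := by
    rcases hk.eq_or_lt with rfl | h2
    · simp at hK ⊢; linarith
    · have h2' : (2:ℝ) ≤ k := by exact_mod_cast h2
      have : Real.log 2 ≤ Real.log k := Real.log_le_log (by norm_num) h2'
      have := Real.log_two_gt_d9
      nlinarith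
  have hLK : L ≤ K := by linarith
  have hK0 : 0 < K := by linarith
  have hVK : V ≤ 32 * K := by linarith
  have hV0 : 0 < V := by positivity
  have hΔ0 : 0 < Δ := by linarith
  set r := Δ / ε with hr
  have hr1 : 1024 < r := by rw [hr, lt_div_iff₀ hε]; exact hΔ
  have e : ε⁻¹ ^ 2 * Δ ^ 2 = r ^ 2 := by rw [hr]; field_simp
  rw [e] at hM
  have hMr : r ^ 2 * V ≤ 16 * M := by
    have : r ^ 2 * V ≤ r ^ 2 * (32 * K) := by gcongr
    linarith
  have hM0 : 0 < M := by
    have : 0 < r ^ 2 * V := by positivity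
    linarith
  have hs : Real.sqrt (M * V) ≤ 4 * M / r := by
    refine Real.sqrt_le_iff.mpr ⟨by positivity, ?_⟩
    rw [div_pow, le_div_iff₀ (by positivity)]
    nlinarith
  refine ⟨m + 1, by linarith, by linarith, ?_, hM0, ?_, ?_⟩
  · rw [← hV]
    have : (64:ℝ) * V ≤ r ^ 2 * V := by gcongr; nlinarith
    linarith
  · have : 4 * M / r < M / 64 := by
      rw [div_lt_div_iff₀ (by positivity) (by norm_num)]
      nlinarith
    linarith
  · rw [div_le_iff₀ hM0]
    have h3 : 2 * Δ * (64 * Real.sqrt (M * V)) ≤ 2 * Δ * (64 * (4 * M / r)) := by gcongr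
    have h4 : 2 * Δ * (64 * (4 * M / r)) = 512 * ε * M := by rw [hr]; field_simp; ring
    have : 0 < ε * M := by positivity
    linarith

end Assembly

/-- generalization across multiple groups: sampling
`n ≥ (2/α_min)·(ε⁻²·Δ²·(k·ln k + ln(2g/δ)) + 4·ln(2g/δ))` labeled agents i.i.d. from a
joint distribution `D` on positions and groups, with probability at least `1 - δ` every
group appears in the sample and, for every set of at most `k` targets and every group,
the empirical average improvement of the group is within `C·ε` of its conditional
expected improvement. -/
theorem generalization_across_groups :
    ∃ C : ℝ, 0 < C ∧
      ∀ (Δ : ℝ), 0 < Δ →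
      ∀ (g : ℕ), 1 ≤ g →
      ∀ (D : Measure (ℝ × Fin g)), IsProbabilityMeasure D →
      ∀ α : Fin g → ℝ, (α = fun ℓ => (D (Set.univ ×ˢ ({ℓ} : Set (Fin g)))).toReal) →
      (∀ ℓ : Fin g, 0 < α ℓ) →
      ∀ (ε δ : ℝ), ε ∈ Set.Ioo (0 : ℝ) 1 → δ ∈ Set.Ioo (0 : ℝ) 1 →
      ∀ (k : ℕ), 1 ≤ k →
      ∀ (n : ℕ),
        (2 / (⨅ ℓ : Fin g, α ℓ)) *
            (ε⁻¹ ^ 2 * Δ ^ 2 * ((k : ℝ) * Real.log k + Real.log (2 * g / δ)) +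
              4 * Real.log (2 * g / δ)) ≤ (n : ℝ) →
        ENNReal.ofReal (1 - δ) ≤
          (Measure.pi fun _ : Fin n => D)
            {sample : Fin n → ℝ × Fin g |
              (∀ ℓ : Fin g, ∃ i : Fin n, (sample i).2 = ℓ) ∧
              ∀ T : Finset ℝ, T.card ≤ k → ∀ ℓ : Fin g,
                |(∑ i, if (sample i).2 = ℓ then imp Δ (sample i).1 T else 0) /
                    ((Finset.univ.filter (fun i : Fin n => (sample i).2 = ℓ)).card : ℝ) -
                  (∫ x, (if x.2 = ℓ then imp Δ x.1 T else 0) ∂D) / α ℓ| ≤ C * ε} := by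
  refine ⟨1024, by norm_num, ?_⟩
  intro Δ hΔ g hg D hD α hα hpos ε δ hε hδ k hk n hn
  obtain ⟨hε0, hε1⟩ := hε
  obtain ⟨hδ0, hδ1⟩ := hδ
  have hg' : (1:ℝ) ≤ g := by exact_mod_cast hg
  have hne : Nonempty (Fin g) := ⟨⟨0, hg⟩⟩
  have hk' : (1:ℝ) ≤ k := by exact_mod_cast hk
  set L := Real.log (2 * g / δ) with hL
  have hLx : (2:ℝ) ≤ 2 * g / δ := by
    rw [le_div_iff₀ hδ0]; nlinarith
  have hL1 : 0.69 ≤ L := by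
    have h1 : Real.log 2 ≤ L := Real.log_le_log (by norm_num) hLx
    have := Real.log_two_gt_d9
    linarith
  have hexpL : (g:ℝ) * Real.exp (-L) = δ / 2 := by
    rw [Real.exp_neg, hL, Real.exp_log (by linarith)]
    field_simp
  have hlog : 0 ≤ (k:ℝ) * Real.log k := by have := Real.log_nonneg hk'; positivity
  set R := ε⁻¹ ^ 2 * Δ ^ 2 * ((k : ℝ) * Real.log k + L) + 4 * L with hR
  have hR0 : 4 * L ≤ R := by
    have : 0 ≤ ε⁻¹ ^ 2 * Δ ^ 2 * ((k : ℝ) * Real.log k + L) :=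
      mul_nonneg (by positivity) (by linarith)
    linarith
  have hMl : ∀ ℓ, 2 * R ≤ n * α ℓ := by
    intro ℓ
    obtain ⟨ℓ0, h0⟩ := exists_eq_ciInf_of_finite (f := α)
    have hle : α ℓ0 ≤ α ℓ := by rw [h0]; exact ciInf_le (Set.finite_range α).bddBelow ℓ
    rw [← h0, div_mul_eq_mul_div, div_le_iff₀ (hpos ℓ0)] at hn
    exact hn.trans (by gcongr)
  by_cases hcase : Δ ≤ 1024 * ε
  · refine (prob_ge (Measure.pi fun _ : Fin n => D)
      {x | ∀ ℓ : Fin g, ∃ i : Fin n, (x i).2 = ℓ} δ ?_).trans (measure_mono ?_)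
    · have e : ({x : Fin n → ℝ × Fin g | ∀ ℓ : Fin g, ∃ i : Fin n, (x i).2 = ℓ})ᶜ =
          ⋃ ℓ, {x | ∀ i, (x i).2 ≠ ℓ} := by
        ext x; simp
      rw [e]
      refine (measureReal_iUnion_fintype_le _).trans ?_
      calc _ ≤ ∑ _ℓ : Fin g, Real.exp (-L) := by
            refine Finset.sum_le_sum fun ℓ _ => (miss_prob D n ℓ).trans ?_
            have h1 := hMl ℓ
            rw [hα] at h1
            exact Real.exp_le_exp.mpr (by simp only at h1; linarith)
        _ = δ / 2 := by
            rw [Finset.sum_const, Finset.card_univ, Fintype.card_fin, nsmul_eq_mul, hexpL]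
        _ ≤ δ := by linarith
    · intro x hx
      exact ⟨hx, fun T _ ℓ => (case_trivial hΔ D α hα hpos n x ℓ (hx ℓ) T).trans hcase⟩
  · push Not at hcase
    have hlam := vol_Ioo_prob
    have hsnd : IsProbabilityMeasure (D.map Prod.snd) :=
      Measure.isProbabilityMeasure_map measurable_snd.aemeasurable
    have hpos' : ∀ ℓ : Fin g, D (Set.univ ×ˢ ({ℓ} : Set (Fin g))) ≠ 0 := by
      intro ℓ h0
      have := hpos ℓ
      rw [hα] at this
      simp only [h0, ENNReal.toReal_zero, lt_irrefl] at this
    obtain ⟨Q, hQm, hQ⟩ := transfer D hpos'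
    have hφ : Measurable (fun y : Set.Ioo (0:ℝ) 1 × Fin g => (Q y.2 y.1, y.2)) :=
      (meas_label Q fun ℓ => (hQm ℓ).measurable).prodMk measurable_snd
    have hv := fun ℓ => numeric (M := n * α ℓ) hk hε0 hcase hL1 (hMl ℓ)
    choose v hv1 hv2 hv3 hv4 hv5 hv6 using hv
    have hev := fun ℓ => group_event D Q hQm hQ hΔ ℓ (α ℓ) (by rw [hα]) n k (v ℓ) hk
      (hv1 ℓ) (hv3 ℓ)
    choose E hEm hEp hEx using hev
    have hpi : (Measure.pi fun _ : Fin n => lamI.prod (D.map Prod.snd)).map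
        (fun x i => ((Q (x i).2 (x i).1, (x i).2) : ℝ × Fin g)) = Measure.pi fun _ : Fin n => D := by
      have : SigmaFinite ((lamI.prod (D.map Prod.snd)).map
          (fun y : Set.Ioo (0:ℝ) 1 × Fin g => (Q y.2 y.1, y.2))) := by rw [hQ]; infer_instance
      have h := Measure.pi_map_pi (μ := fun _ : Fin n => lamI.prod (D.map Prod.snd))
        (f := fun _ y => ((Q y.2 y.1, y.2) : ℝ × Fin g)) (fun _ => hφ.aemeasurable)
      rw [h, hQ]
    have hφn : Measurable (fun (x : Fin n → Set.Ioo (0:ℝ) 1 × Fin g) i =>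
        ((Q (x i).2 (x i).1, (x i).2) : ℝ × Fin g)) :=
      measurable_pi_lambda _ fun i => hφ.comp (measurable_pi_apply i)
    rw [← hpi]
    refine le_trans ?_ (Measure.le_map_apply hφn.aemeasurable _)
    refine (prob_ge (Measure.pi fun _ : Fin n => lamI.prod (D.map Prod.snd))
      (⋂ ℓ, E ℓ) δ ?_).trans (measure_mono ?_)
    · rw [Set.compl_iInter]
      refine (measureReal_iUnion_fintype_le _).trans ?_
      calc _ ≤ ∑ _ℓ : Fin g, 2 * Real.exp (-L) := by
            refine Finset.sum_le_sum fun ℓ _ => (hEp ℓ).trans ?_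
            have := hv2 ℓ
            gcongr
        _ = 2 * (g * Real.exp (-L)) := by
            rw [Finset.sum_const, Finset.card_univ, Fintype.card_fin, nsmul_eq_mul]; ring
        _ ≤ δ := by rw [hexpL]; linarith
    · intro x hx
      rw [Set.mem_iInter] at hx
      have key : ∀ ℓ T, T.card ≤ k →
          0 < ((Finset.univ.filter (fun i : Fin n => (x i).2 = ℓ)).card : ℝ) ∧
          |(∑ i, if (x i).2 = ℓ then imp Δ (Q (x i).2 (x i).1) T else 0) /
              ((Finset.univ.filter (fun i : Fin n => (x i).2 = ℓ)).card : ℝ) -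
            (∫ y, (if y.2 = ℓ then imp Δ y.1 T else 0) ∂D) / α ℓ| ≤ 1024 * ε := by
        intro ℓ T hT
        obtain ⟨h1, h2⟩ := hEx ℓ x (hx ℓ)
        obtain ⟨s0, s1⟩ := sum_ite_bounds hΔ (fun i => (Q (x i).2 (x i).1, (x i).2)) T ℓ
        obtain ⟨r1, r2⟩ := ratio_bound (hpos ℓ) rfl (hv4 ℓ) hΔ s0 s1 (h2 T hT) h1 (hv5 ℓ)
        exact ⟨r1, r2.trans (hv6 ℓ)⟩
      refine ⟨fun ℓ => ?_, fun T hT ℓ => (key ℓ T hT).2⟩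
      have h := (key ℓ ∅ (by simp)).1
      obtain ⟨i, hi⟩ := Finset.card_pos.mp (by exact_mod_cast h)
      exact ⟨i, (Finset.mem_filter.mp hi).2⟩
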